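/- Let T be the standard baker's map, T(x,y) = (x/2, 2y) if y < 1/2 and T(x,y) = ((x+1)/2, 2y−1) if y ≥ 1/2, preserving Lebesgue measure Leb on [0,1]². Let z ∈ (0,1)² be a periodic point of minimal period p whose coordinates are both non-dyadic, and set θ = 1 − 2^{−p}. Then for every t > 0 and every integer k ≥ 1, Leb( { x ∈ [0,1]² : ∑_{i=0}^{⌊ t / Leb(B_∞(z,r)) ⌋} 1_{B_∞(z,r)}(T^i x) = k } ) → e^{−θt} ∑_{j=1}^{k} (1−θ)^{k−j} θ^{2j} (t^j / j!) · C(k−1, j−1) as r → 0, where B_∞(z,r) is the open ball in the ℓ^∞ (sup) metric and C(k−1, j−1) is the binomial coefficient. -/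

import Mathlib

open MeasureTheory Filter
open scoped Classical Topology

/-- A real number is non-dyadic if it is not of the form `m / 2^ℓ`. -/
def Nondyadic (x : ℝ) : Prop := ∀ (m : ℤ) (l : ℕ), x ≠ (m : ℝ) / 2 ^ l

/-- The standard baker's map: `T(x,y) = (x/2, 2y)` if `y < 1/2` and
`T(x,y) = ((x+1)/2, 2y-1)` if `y ≥ 1/2`. -/
noncomputable def bakerMap (p : ℝ × ℝ) : ℝ × ℝ :=
  if p.2 < 1 / 2 then (p.1 / 2, 2 * p.2) else ((p.1 + 1) / 2, 2 * p.2 - 1)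

/-- The unit square `[0,1]²`. -/
def unitSq : Set (ℝ × ℝ) := Set.Icc (0:ℝ) 1 ×ˢ Set.Icc (0:ℝ) 1


/-! ### Part 1 : Fourier coefficients of the limit law -/

lemma HasSum.congr_fun' {ι E : Type} [AddCommMonoid E] [TopologicalSpace E] {f g : ι → E} {a : E}
    (h : HasSum f a) (hfg : ∀ i, g i = f i) : HasSum g a := by
  rw [show g = f from funext hfg]; exact h

lemma aux_int_exp (m : ℤ) :
    ∫ u in (0:ℝ)..(2 * Real.pi), Complex.exp ((m * Complex.I) * u) =
      if m = 0 then (2 * Real.pi : ℂ) else 0 := by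
  split_ifs with h
  · subst h; simp
  · rw [integral_exp_mul_complex (by simpa using h)]
    have : (m * Complex.I) * ((2 * Real.pi : ℝ) : ℂ) = m * (2 * Real.pi * Complex.I) := by
      push_cast; ring
    rw [this, Complex.exp_int_mul_two_pi_mul_I]
    simp

lemma aux_fourier_sum {ι : Type} [Countable ι] (a : ι → ℂ) (m : ι → ℤ)
    (ha : Summable fun i => ‖a i‖) (f : ℝ → ℂ)
    (hf : ∀ u : ℝ, HasSum (fun i => a i * Complex.exp ((m i * Complex.I) * u)) (f u)) :
    HasSum (fun i => a i * (if m i = 0 then (2 * Real.pi : ℂ) else 0))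
      (∫ u in (0:ℝ)..(2 * Real.pi), f u) := by
  have := intervalIntegral.hasSum_integral_of_dominated_convergence (a := 0) (b := 2 * Real.pi)
    (μ := volume) (F := fun i u => a i * Complex.exp ((m i * Complex.I) * (u:ℝ))) (f := f)
    (fun i _ => ‖a i‖) ?_ ?_ ?_ ?_ ?_
  · simpa [intervalIntegral.integral_const_mul, aux_int_exp] using this
  · intro i
    exact (by fun_prop : Continuous fun u : ℝ =>
      a i * Complex.exp ((m i * Complex.I) * (u:ℝ))).aestronglyMeasurable
  · intro i
    refine Eventually.of_forall fun u _ => ?_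
    rw [norm_mul]
    have : (m i * Complex.I) * (u:ℂ) = ((m i * u : ℝ) : ℂ) * Complex.I := by push_cast; ring
    rw [this, Complex.norm_exp_ofReal_mul_I, mul_one]
  · exact Eventually.of_forall fun u _ => ha
  · simp
  · exact Eventually.of_forall fun u _ => hf u

/-- the exponent -/
noncomputable def lamC (θ : ℝ) (s : ℂ) : ℂ := (1 - s) * (θ / (1 - (1 - θ) * s))

lemma one_sub_ne (θ : ℝ) (h0 : 0 < θ) (h1 : θ ≤ 1) (s : ℂ) (hs : ‖s‖ = 1) :
    ‖((1 - θ : ℝ) : ℂ) * s‖ < 1 := by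
  rw [norm_mul, hs, mul_one, Complex.norm_real, Real.norm_eq_abs, abs_of_nonneg (by linarith)]
  linarith

lemma lamC_eq (θ : ℝ) (h0 : 0 < θ) (h1 : θ ≤ 1) (s : ℂ) (hs : ‖s‖ = 1) :
    lamC θ s = θ - θ * (θ * s / (1 - ((1 - θ : ℝ) : ℂ) * s)) := by
  have h := one_sub_ne θ h0 h1 s hs
  have h2 : 1 - ((1 - θ : ℝ) : ℂ) * s ≠ 0 := by
    intro h3
    have : ((1 - θ : ℝ) : ℂ) * s = 1 := by linear_combination -h3
    rw [this] at h; simp at h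
  unfold lamC
  obtain ⟨d, hd⟩ : ∃ d : ℂ, d = 1 - ((1 - θ : ℝ) : ℂ) * s := ⟨_, rfl⟩
  have hd' : 1 - (1 - (θ:ℂ)) * s = d := by rw [hd]; push_cast; ring
  rw [hd', ← hd]
  rw [← hd] at h2
  field_simp
  rw [hd]
  push_cast
  ring

lemma limit_coeff (θ t : ℝ) (h0 : 0 < θ) (h1 : θ ≤ 1) (k : ℕ) (hk : 1 ≤ k) :
    ∫ u in (0:ℝ)..(2 * Real.pi), Complex.exp ((((-k : ℤ) : ℂ) * Complex.I) * u) *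
        Complex.exp (-(lamC θ (Complex.exp (u * Complex.I)) * t)) =
      2 * Real.pi * ((Real.exp (-(θ * t)) *
          ∑ j ∈ Finset.Icc 1 k,
            (1 - θ) ^ (k - j) * θ ^ (2 * j) * t ^ j / (Nat.factorial j) *
              ((k - 1).choose (j - 1)) : ℝ) : ℂ) := by
  set q : ℝ := 1 - θ with hq
  have hq0 : 0 ≤ q := by rw [hq]; linarith
  have hq1 : q < 1 := by rw [hq]; linarith
  -- coefficients
  let A : ℕ → ℂ := fun j => (θ * θ * t) ^ (j + 1) / (Nat.factorial (j + 1))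
  let a : ℕ × ℕ → ℂ := fun x => A x.1 * (((x.2 + x.1).choose x.1 : ℂ) * (q:ℂ) ^ x.2)
  have hqn : ‖(q:ℂ)‖ < 1 := by
    rw [Complex.norm_real, Real.norm_eq_abs, abs_of_nonneg hq0]; exact hq1
  have hgeom : ∀ j, HasSum (fun n : ℕ => ‖((n + j).choose j : ℂ) * (q:ℂ) ^ n‖)
      (1 / (1 - q) ^ (j + 1)) := by
    intro j
    have := hasSum_choose_mul_geometric_of_norm_lt_one j (r := q)
      (by rwa [Real.norm_eq_abs, abs_of_nonneg hq0])
    refine this.congr_fun' fun n => ?_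
    rw [norm_mul, norm_pow, Complex.norm_natCast, Complex.norm_real, Real.norm_eq_abs,
      abs_of_nonneg hq0]
  have ha : Summable fun x => ‖a x‖ := by
    rw [summable_prod_of_nonneg (fun x => norm_nonneg _)]
    constructor
    · intro j
      simp only [a, norm_mul (A _)]
      exact (hgeom j).summable.mul_left _
    · have : ∀ j, ∑' n, ‖a (j, n)‖ = (‖(θ * θ * t)‖ / (1 - q)) ^ (j + 1) / (Nat.factorial (j + 1)) := by
        intro j
        simp only [a, norm_mul (A _)]
        rw [tsum_mul_left, (hgeom j).tsum_eq]
        simp only [A, norm_div, norm_pow, Complex.norm_natCast]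
        rw [div_pow]
        have : ‖(θ * θ * t : ℂ)‖ = ‖θ * θ * t‖ := by
          rw [← Complex.norm_real]; push_cast; rfl
        rw [this]
        ring
      simp_rw [this]
      exact (summable_nat_add_iff 1).2 (Real.summable_pow_div_factorial _)
  have key := aux_fourier_sum a (fun x => (x.1 + x.2 + 1 : ℤ) - k) ha
    (fun u => Complex.exp ((((-k : ℤ) : ℂ) * Complex.I) * u) *
        (Complex.exp (θ * t * (θ * Complex.exp (u * Complex.I) /
          (1 - (q:ℂ) * Complex.exp (u * Complex.I)))) - 1)) ?_
  swap
  · intro u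
    set s := Complex.exp (u * Complex.I) with hs
    have hsn : ‖s‖ = 1 := by rw [hs, Complex.norm_exp_ofReal_mul_I]
    set e := Complex.exp ((((-k : ℤ) : ℂ) * Complex.I) * u) with he
    have hterm : ∀ x : ℕ × ℕ, a x * Complex.exp ((((x.1 + x.2 + 1 : ℤ) - k : ℤ) * Complex.I) * u)
        = e * (A x.1 * s ^ (x.1 + 1) * (((x.2 + x.1).choose x.1 : ℂ) * ((q:ℂ) * s) ^ x.2)) := by
      intro x
      have : Complex.exp ((((x.1 + x.2 + 1 : ℤ) - k : ℤ) * Complex.I) * u) =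
          e * s ^ (x.1 + 1 + x.2) := by
        rw [he, hs, ← Complex.exp_nat_mul, ← Complex.exp_add]
        congr 1
        push_cast
        ring
      rw [this, pow_add, mul_pow]
      simp only [a]
      ring
    have hsum : Summable fun x : ℕ × ℕ =>
        a x * Complex.exp ((((x.1 + x.2 + 1 : ℤ) - k : ℤ) * Complex.I) * u) := by
      refine Summable.of_norm ?_
      refine ha.congr fun x => ?_
      rw [norm_mul (a x)]
      have : ((((x.1 + x.2 + 1 : ℤ) - k : ℤ) * Complex.I) * (u:ℂ)) =
        (((((x.1 + x.2 + 1 : ℤ) - k : ℤ):ℝ) * u : ℝ) : ℂ) * Complex.I := by push_cast; ring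
      rw [this, Complex.norm_exp_ofReal_mul_I, mul_one]
    have h2 := hsum.hasSum
    have h3 := h2.prod_fiberwise (g := fun j => e * ((θ * t * (θ * s / (1 - q * s))) ^ (j + 1) /
      (Nat.factorial (j + 1)))) ?_
    · have h4 : HasSum (fun j : ℕ => e * ((θ * t * (θ * s / (1 - q * s))) ^ (j + 1) /
        (Nat.factorial (j + 1)))) (e * (Complex.exp (θ * t * (θ * s / (1 - q * s))) - 1)) := by
        refine HasSum.mul_left _ ?_
        have := NormedSpace.expSeries_div_hasSum_exp (𝔸 := ℂ) (θ * t * (θ * s / (1 - q * s)))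
        rw [← hasSum_nat_add_iff' 1] at this
        simpa [Complex.exp_eq_exp_ℂ] using this
      rw [← h3.unique h4]
      exact h2
    · intro j
      refine HasSum.congr_fun' ?_ fun n => hterm (j, n)
      have hg := hasSum_choose_mul_geometric_of_norm_lt_one j (r := (q:ℂ) * s)
        (by rw [norm_mul, hsn, mul_one]; exact hqn)
      have := (hg.mul_left (A j * s ^ (j + 1))).mul_left e
      have hv : e * ((θ * t * (θ * s / (1 - q * s))) ^ (j + 1) / (Nat.factorial (j + 1))) =
          e * (A j * s ^ (j + 1) * (1 / (1 - q * s) ^ (j + 1))) := by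
        simp only [A]
        rw [mul_pow, div_pow, mul_pow, mul_pow, mul_pow, mul_pow]
        ring
      rw [hv]
      exact this
  -- now compute
  have hfin : HasSum (fun x : ℕ × ℕ => a x * (if ((x.1 + x.2 + 1 : ℤ) - k) = 0 then (2 * Real.pi : ℂ) else 0))
      (∑ x ∈ Finset.HasAntidiagonal.antidiagonal (k - 1), a x * (2 * Real.pi : ℂ)) := by
    have : ∑ x ∈ Finset.HasAntidiagonal.antidiagonal (k - 1), a x * (2 * Real.pi : ℂ) =
      ∑ x ∈ Finset.HasAntidiagonal.antidiagonal (k - 1), a x * (if ((x.1 + x.2 + 1 : ℤ) - k) = 0 then (2 * Real.pi : ℂ) else 0) := by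
      refine Finset.sum_congr rfl fun x hx => ?_
      rw [Finset.HasAntidiagonal.mem_antidiagonal] at hx
      rw [if_pos (by omega)]
    rw [this]
    refine hasSum_sum_of_ne_finset_zero fun x hx => ?_
    rw [Finset.HasAntidiagonal.mem_antidiagonal] at hx
    rw [if_neg (by omega), mul_zero]
  have hval := key.unique hfin
  have hint0 : ∫ u in (0:ℝ)..(2 * Real.pi), Complex.exp ((((-k : ℤ) : ℂ) * Complex.I) * u) = 0 := by
    rw [aux_int_exp, if_neg (by omega)]
  have hcont : Continuous fun u : ℝ => Complex.exp ((((-k : ℤ) : ℂ) * Complex.I) * u) := by fun_prop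
  have hne : ∀ u : ℝ, (1 - (q:ℂ) * Complex.exp (u * Complex.I)) ≠ 0 := by
    intro u h3
    have h := one_sub_ne θ h0 h1 (Complex.exp (u * Complex.I)) (Complex.norm_exp_ofReal_mul_I u)
    have : ((1 - θ : ℝ) : ℂ) * (Complex.exp (u * Complex.I)) = 1 := by linear_combination -h3
    rw [this] at h; simp at h
  have hcont2 : Continuous fun u : ℝ => Complex.exp ((((-k : ℤ) : ℂ) * Complex.I) * u) *
        (Complex.exp (θ * t * (θ * Complex.exp (u * Complex.I) /
          (1 - (q:ℂ) * Complex.exp (u * Complex.I)))) - 1) := by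
    have : Continuous fun u : ℝ => (θ * Complex.exp (u * Complex.I) /
          (1 - (q:ℂ) * Complex.exp (u * Complex.I))) := by
      refine Continuous.div (by fun_prop) (by fun_prop) hne
    fun_prop
  have hexpr : ∀ u : ℝ, Complex.exp ((((-k : ℤ) : ℂ) * Complex.I) * u) *
        Complex.exp (-(lamC θ (Complex.exp (u * Complex.I)) * t)) =
      Complex.exp (-(θ * t)) * (Complex.exp ((((-k : ℤ) : ℂ) * Complex.I) * u) *
        (Complex.exp (θ * t * (θ * Complex.exp (u * Complex.I) /
          (1 - (q:ℂ) * Complex.exp (u * Complex.I)))) - 1) +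
          Complex.exp ((((-k : ℤ) : ℂ) * Complex.I) * u)) := by
    intro u
    rw [lamC_eq θ h0 h1 _ (Complex.norm_exp_ofReal_mul_I u)]
    have : Complex.exp (-((θ - θ * (θ * Complex.exp (u * Complex.I) /
        (1 - ((1 - θ : ℝ) : ℂ) * Complex.exp (u * Complex.I)))) * t)) =
        Complex.exp (-(θ * t)) * Complex.exp (θ * t * (θ * Complex.exp (u * Complex.I) /
          (1 - (q:ℂ) * Complex.exp (u * Complex.I)))) := by
      rw [← Complex.exp_add]; congr 1; ring
    rw [this]; ring
  simp_rw [hexpr]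
  rw [intervalIntegral.integral_const_mul, intervalIntegral.integral_add
    (hcont2.intervalIntegrable _ _) (hcont.intervalIntegrable _ _), hint0, hval,
    Finset.Nat.sum_antidiagonal_eq_sum_range_succ_mk, ← Finset.sum_mul]
  have hk' : (k - 1).succ = k := by omega
  rw [hk']
  have : ∑ j ∈ Finset.range k, a (j, k - 1 - j) = ((∑ j ∈ Finset.Icc 1 k,
            q ^ (k - j) * θ ^ (2 * j) * t ^ j / (Nat.factorial j) *
              ((k - 1).choose (j - 1)) : ℝ) : ℂ) := by
    rw [Complex.ofReal_sum, Finset.range_eq_Ico, ← Finset.Ico_succ_right_eq_Icc,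
      Finset.sum_Ico_eq_sum_range, Finset.sum_Ico_eq_sum_range]
    simp only [Nat.sub_zero, zero_add, Order.succ_eq_add_one, Nat.add_sub_cancel]
    refine Finset.sum_congr rfl fun j hj => ?_
    rw [Finset.mem_range] at hj
    simp only [a, A]
    have e1 : k - 1 - j + j = k - 1 := by omega
    have e2 : k - (1 + j) = k - 1 - j := by omega
    have e3 : 1 + j - 1 = j := by omega
    rw [e1, e2, e3]
    push_cast
    rw [add_comm 1 j]
    ring
  rw [this]
  push_cast
  ring

/-! ### Part 2 : the invariant measure -/

noncomputable def nuU : Measure ℝ := volume.restrict (Set.Ico (0:ℝ) 1)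

noncomputable def muQ : Measure (ℝ × ℝ) := nuU.prod nuU

instance : IsProbabilityMeasure nuU := ⟨by simp [nuU]⟩

instance : IsProbabilityMeasure muQ := by unfold muQ; infer_instance

lemma muQ_eq_restrict : muQ = volume.restrict (Set.Ico (0:ℝ) 1 ×ˢ Set.Ico (0:ℝ) 1) := by
  unfold muQ nuU
  rw [Measure.prod_restrict]; rfl

lemma restrict_unitSq : volume.restrict unitSq = muQ := by
  unfold muQ nuU unitSq
  rw [Measure.restrict_congr_set (Ico_ae_eq_Icc (μ := (volume : Measure ℝ)) (a := (0:ℝ)) (b := 1)),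
    Measure.prod_restrict]
  rfl

lemma measurable_baker : Measurable bakerMap := by
  unfold bakerMap
  refine Measurable.ite (measurableSet_lt measurable_snd measurable_const) ?_ ?_
  · fun_prop
  · fun_prop

lemma mp_L0 : MeasurePreserving (fun w : ℝ × ℝ => ((1/2 : ℝ) * w.1, (2:ℝ) * w.2)) volume volume := by
  refine ⟨by fun_prop, ?_⟩
  have h := Measure.map_prod_map (volume : Measure ℝ) (volume : Measure ℝ)
    (f := fun x : ℝ => (1/2 : ℝ) * x) (g := fun x : ℝ => (2:ℝ) * x) (by fun_prop) (by fun_prop)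
  rw [Real.map_volume_mul_left (by norm_num), Real.map_volume_mul_left (by norm_num),
    Measure.prod_smul_left, Measure.prod_smul_right, smul_smul] at h
  change Measure.map (Prod.map (fun x : ℝ => (1/2 : ℝ) * x) (fun x : ℝ => (2:ℝ) * x))
    ((volume : Measure ℝ).prod volume) = _
  rw [← h, ← ENNReal.ofReal_mul (by positivity)]
  norm_num
  rfl

lemma mp_L1 : MeasurePreserving (fun w : ℝ × ℝ => ((w.1 + 1) / 2, (2:ℝ) * w.2 - 1)) volume volume := by
  have := (measurePreserving_add_right (volume : Measure (ℝ × ℝ)) ((1/2 : ℝ), (-1 : ℝ))).comp mp_L0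
  convert this using 1
  ext w <;> simp <;> ring

lemma mp_baker : MeasurePreserving bakerMap muQ muQ := by
  refine ⟨measurable_baker, ?_⟩
  ext S hS
  rw [Measure.map_apply measurable_baker hS, muQ_eq_restrict,
    Measure.restrict_apply (measurable_baker hS), Measure.restrict_apply hS]
  have hI : ∀ a b : ℝ, MeasurableSet (Set.Ico a b) := fun a b => measurableSet_Ico
  have hA : MeasurableSet (S ∩ (Set.Ico (0:ℝ) (1/2) ×ˢ Set.Ico (0:ℝ) 1)) :=
    hS.inter ((hI _ _).prod (hI _ _))
  have hB : MeasurableSet (S ∩ (Set.Ico (1/2:ℝ) 1 ×ˢ Set.Ico (0:ℝ) 1)) :=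
    hS.inter ((hI _ _).prod (hI _ _))
  have e1 : bakerMap ⁻¹' S ∩ (Set.Ico (0:ℝ) 1 ×ˢ Set.Ico (0:ℝ) 1) =
      ((fun w : ℝ × ℝ => ((1/2 : ℝ) * w.1, (2:ℝ) * w.2)) ⁻¹'
        (S ∩ (Set.Ico (0:ℝ) (1/2) ×ˢ Set.Ico (0:ℝ) 1))) ∪
      ((fun w : ℝ × ℝ => ((w.1 + 1) / 2, (2:ℝ) * w.2 - 1)) ⁻¹'
        (S ∩ (Set.Ico (1/2:ℝ) 1 ×ˢ Set.Ico (0:ℝ) 1))) := by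
    ext w
    simp only [Set.mem_inter_iff, Set.mem_preimage, Set.mem_union, Set.mem_prod, Set.mem_Ico,
      bakerMap]
    have hh : (1/2 : ℝ) * w.1 = w.1 / 2 := by ring
    rw [hh]
    constructor
    · rintro ⟨h, h1, h2⟩
      by_cases hy : w.2 < 1/2
      · left
        rw [if_pos hy] at h
        exact ⟨h, ⟨by linarith, by linarith⟩, by linarith, by linarith⟩
      · right
        rw [if_neg hy] at h
        exact ⟨h, ⟨by linarith, by linarith⟩, by linarith, by linarith⟩
    · rintro (⟨h, h1, h2⟩ | ⟨h, h1, h2⟩)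
      · rw [if_pos (by linarith)]
        exact ⟨h, ⟨by linarith, by linarith⟩, by linarith, by linarith⟩
      · rw [if_neg (by linarith)]
        exact ⟨h, ⟨by linarith, by linarith⟩, by linarith, by linarith⟩
  have e2 : S ∩ (Set.Ico (0:ℝ) 1 ×ˢ Set.Ico (0:ℝ) 1) =
      (S ∩ (Set.Ico (0:ℝ) (1/2) ×ˢ Set.Ico (0:ℝ) 1)) ∪
        (S ∩ (Set.Ico (1/2:ℝ) 1 ×ˢ Set.Ico (0:ℝ) 1)) := by
    rw [← Set.inter_union_distrib_left, ← Set.union_prod, Set.Ico_union_Ico_eq_Ico] <;> norm_num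
  rw [e1, e2, measure_union _ (mp_L1.measurable hB), measure_union _ hB,
    mp_L0.measure_preimage hA.nullMeasurableSet, mp_L1.measure_preimage hB.nullMeasurableSet]
  · rw [Set.disjoint_left]
    rintro w ⟨_, h⟩ ⟨_, h'⟩
    simp only [Set.mem_prod, Set.mem_Ico] at h h'
    linarith
  · rw [Set.disjoint_left]
    rintro w ⟨_, h⟩ ⟨_, h'⟩
    simp only [Set.mem_prod, Set.mem_Ico] at h h'
    linarith

lemma mp_iter (j : ℕ) : MeasurePreserving (bakerMap^[j]) muQ muQ := mp_baker.iterate j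

lemma measurable_iter (j : ℕ) : Measurable (bakerMap^[j]) := (mp_iter j).measurable

lemma integral_comp_iter {E : Type} [NormedAddCommGroup E] [NormedSpace ℝ E] (j : ℕ)
    {f : ℝ × ℝ → E} (hf : StronglyMeasurable f) :
    ∫ w, f (bakerMap^[j] w) ∂muQ = ∫ w, f w ∂muQ := by
  have := integral_map (μ := muQ) (φ := bakerMap^[j]) (measurable_iter j).aemeasurable (f := f)
    hf.aestronglyMeasurable
  rw [(mp_iter j).map_eq] at this
  exact this.symm

lemma snd_iter (j : ℕ) (w : ℝ × ℝ) (hw : w.2 ∈ Set.Ico (0:ℝ) 1) :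
    (bakerMap^[j] w).2 = Int.fract (2 ^ j * w.2) := by
  induction j with
  | zero => simp [Int.fract_eq_self.2 hw]
  | succ j ih =>
    rw [Function.iterate_succ_apply']
    set v := bakerMap^[j] w
    have h0 := Int.fract_nonneg (2 ^ j * w.2)
    have h1 := Int.fract_lt_one (2 ^ j * w.2)
    rw [← ih] at h0 h1
    have h2 : (2:ℝ) ^ (j+1) * w.2 = 2 * v.2 + ((2 * ⌊2 ^ j * w.2⌋ : ℤ) : ℝ) := by
      rw [ih, Int.fract]; push_cast; ring
    rw [h2, Int.fract_add_intCast]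
    unfold bakerMap
    split_ifs with h
    · symm; rw [Int.fract_eq_iff]
      exact ⟨by simp; linarith, by simp; linarith, 0, by simp⟩
    · symm; rw [Int.fract_eq_iff]
      exact ⟨by simp; linarith, by simp; linarith, 1, by simp⟩

lemma iter_fst (j : ℕ) (x x' y : ℝ) :
    (bakerMap^[j] (x, y)).1 - (bakerMap^[j] (x', y)).1 = (x - x') / 2 ^ j ∧
    (bakerMap^[j] (x, y)).2 = (bakerMap^[j] (x', y)).2 := by
  induction j with
  | zero => simp
  | succ j ih =>
    rw [Function.iterate_succ_apply', Function.iterate_succ_apply']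
    obtain ⟨h1, h2⟩ := ih
    unfold bakerMap at *
    rw [h2]
    have : (x - x') / 2 ^ (j+1) = ((x - x') / 2 ^ j) / 2 := by rw [pow_succ]; field_simp
    rw [this, ← h1]
    split_ifs <;> exact ⟨by ring, rfl⟩

lemma per_split {E : Type} [NormedAddCommGroup E] [NormedSpace ℝ E] (P : ℝ → E)
    (hP : Function.Periodic P 1) (hi : ∀ a b : ℝ, IntervalIntegrable P volume a b) (A B : ℝ) :
    ∫ y in A..B, P y = (⌊B - A⌋ : ℝ) • (∫ y in (0:ℝ)..1, P y) + ∫ y in (A + ⌊B - A⌋)..B, P y := by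
  have h := hP.intervalIntegral_add_zsmul_eq ⌊B - A⌋ A hi
  rw [hP.intervalIntegral_add_eq A 0] at h
  rw [← intervalIntegral.integral_add_adjacent_intervals (hi A (A + ⌊B - A⌋)) (hi _ B)]
  congr 1
  simpa [Int.cast_smul_eq_zsmul] using h

lemma per_meas {E : Type} [NormedAddCommGroup E] [NormedSpace ℝ E] (ψ : ℝ → E)
    (hm : StronglyMeasurable ψ) (hb : ∀ y, ‖ψ y‖ ≤ 1) (a b : ℝ) :
    IntervalIntegrable (fun y => ψ (Int.fract y)) volume a b := by
  rw [intervalIntegrable_iff]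
  haveI : IsFiniteMeasure ((volume : Measure ℝ).restrict (Set.uIoc a b)) :=
    ⟨by rw [Measure.restrict_apply_univ, Set.uIoc]; exact measure_Ioc_lt_top⟩
  refine Integrable.of_bound (hm.comp_measurable measurable_fract).aestronglyMeasurable 1 ?_
  exact Eventually.of_forall fun y => hb _

lemma per_fract {E : Type} (ψ : ℝ → E) : Function.Periodic (fun y => ψ (Int.fract y)) 1 := by
  intro y; simp

lemma int_fract {E : Type} [NormedAddCommGroup E] [NormedSpace ℝ E] (ψ : ℝ → E) :
    ∫ y in (0:ℝ)..1, ψ (Int.fract y) = ∫ y, ψ y ∂nuU := by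
  rw [intervalIntegral.integral_of_le zero_le_one, ← integral_Ico_eq_integral_Ioc]
  unfold nuU
  refine setIntegral_congr_fun measurableSet_Ico fun y hy => ?_
  simp only [Int.fract_eq_self.2 hy]

lemma decorr (ψ : ℝ → ℂ) (hm : StronglyMeasurable ψ) (hb : ∀ y, ‖ψ y‖ ≤ 1) (a b : ℝ)
    (j : ℕ) :
    ‖(∫ y in a..b, ψ (Int.fract (2 ^ j * y))) - (b - a) * ∫ y, ψ y ∂nuU‖ ≤ 2 / 2 ^ j := by
  have h2 : (0:ℝ) < 2 ^ j := by positivity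
  have h := intervalIntegral.integral_comp_mul_left (a := a) (b := b) (c := (2:ℝ) ^ j)
    (fun y => ψ (Int.fract y)) h2.ne'
  rw [h, per_split _ (per_fract ψ) (per_meas ψ hm hb), int_fract]
  set A := 2 ^ j * a
  set B := 2 ^ j * b
  set I := ∫ y, ψ y ∂nuU
  have hI : ‖I‖ ≤ 1 := by
    have := norm_integral_le_of_norm_le_const (μ := nuU) (f := ψ) (C := 1) (Eventually.of_forall hb)
    simpa using this
  have hR : ‖∫ y in (A + ⌊B - A⌋)..B, ψ (Int.fract y)‖ ≤ Int.fract (B - A) := by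
    have := intervalIntegral.norm_integral_le_of_norm_le_const (a := A + ⌊B - A⌋) (b := B)
      (f := fun y => ψ (Int.fract y)) (C := 1) (fun y _ => hb _)
    refine this.trans ?_
    have : B - (A + ⌊B - A⌋) = Int.fract (B - A) := by rw [Int.fract]; ring
    rw [this, one_mul, abs_of_nonneg (Int.fract_nonneg _)]
  set R := ∫ y in (A + ⌊B - A⌋)..B, ψ (Int.fract y)
  have e : ((2:ℝ)^j)⁻¹ • ((⌊B - A⌋ : ℝ) • I + R) - (b - a) * I =
      ((2:ℝ)^j)⁻¹ • (R - ((Int.fract (B - A) : ℝ) : ℂ) * I) := by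
    have : ((Int.fract (B - A) : ℝ) : ℂ) = 2 ^ j * b - 2 ^ j * a - ((⌊B - A⌋ : ℝ) : ℂ) := by
      rw [Int.fract]; simp only [A, B]; push_cast; ring
    rw [this]
    have h3 : (2:ℂ) ^ j ≠ 0 := pow_ne_zero _ (by norm_num)
    simp only [Complex.real_smul]
    push_cast
    field_simp
    ring
  rw [e, norm_smul, Real.norm_eq_abs, abs_of_pos (by positivity), div_eq_inv_mul]
  refine mul_le_mul_of_nonneg_left ?_ (by positivity)
  refine (norm_sub_le _ _).trans ?_
  rw [norm_mul, Complex.norm_real, Real.norm_eq_abs, abs_of_nonneg (Int.fract_nonneg _)]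
  have := Int.fract_lt_one (B - A)
  have := Int.fract_nonneg (B - A)
  nlinarith [norm_nonneg I]

lemma upper (ψ : ℝ → ℝ) (hm : StronglyMeasurable ψ) (h0 : ∀ y, 0 ≤ ψ y) (h1 : ∀ y, ψ y ≤ 1)
    (a b : ℝ) (hab : a ≤ b) (j : ℕ) :
    (∫ y in a..b, ψ (Int.fract (2 ^ j * y))) ≤ (b - a + 1 / 2 ^ j) * ∫ y, ψ y ∂nuU := by
  have hb : ∀ y, ‖ψ y‖ ≤ 1 := fun y => by rw [Real.norm_eq_abs, abs_of_nonneg (h0 y)]; exact h1 y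
  have h2 : (0:ℝ) < 2 ^ j := by positivity
  have h := intervalIntegral.integral_comp_mul_left (a := a) (b := b) (c := (2:ℝ) ^ j)
    (fun y => ψ (Int.fract y)) h2.ne'
  rw [h, per_split _ (per_fract ψ) (per_meas ψ hm hb), int_fract]
  set A := 2 ^ j * a
  set B := 2 ^ j * b
  set I := ∫ y, ψ y ∂nuU with hI
  have hI0 : 0 ≤ I := integral_nonneg h0
  have hf0 := Int.fract_nonneg (B - A)
  have hf1 := Int.fract_lt_one (B - A)
  have hfe : Int.fract (B - A) = B - A - ⌊B - A⌋ := rfl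
  have hR : ∫ y in (A + ⌊B - A⌋)..B, ψ (Int.fract y) ≤ I := by
    have hper := (per_fract ψ).intervalIntegral_add_eq (A + ⌊B - A⌋) 0
    rw [zero_add] at hper
    rw [hI, ← int_fract, ← hper]
    refine intervalIntegral.integral_mono_interval le_rfl (by linarith) (by linarith) ?_
      (per_meas ψ hm hb _ _)
    exact Eventually.of_forall fun y => h0 _
  set R := ∫ y in (A + ⌊B - A⌋)..B, ψ (Int.fract y)
  have hle : (⌊B - A⌋ : ℝ) * I + R ≤ (B - A + 1) * I := by nlinarith
  simp only [smul_eq_mul]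
  calc ((2:ℝ) ^ j)⁻¹ * ((⌊B - A⌋ : ℝ) * I + R) ≤ ((2:ℝ) ^ j)⁻¹ * ((B - A + 1) * I) :=
        mul_le_mul_of_nonneg_left hle (by positivity)
    _ = (b - a + 1 / 2 ^ j) * I := by
        simp only [A, B]; field_simp

/-! ### Part 3 : counting functions -/

noncomputable def ind (U : Set (ℝ × ℝ)) (w : ℝ × ℝ) : ℕ := U.indicator (fun _ => (1:ℕ)) w

noncomputable def cnt (U : Set (ℝ × ℝ)) (n : ℕ) (w : ℝ × ℝ) : ℕ :=
  ∑ i ∈ Finset.range n, ind U (bakerMap^[i] w)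

noncomputable def FF (s : ℂ) (U : Set (ℝ × ℝ)) (n : ℕ) : ℂ := ∫ w, s ^ (cnt U n w) ∂muQ

lemma ind_of_mem {U : Set (ℝ × ℝ)} {w : ℝ × ℝ} (h : w ∈ U) : ind U w = 1 := by simp [ind, h]

lemma ind_of_notMem {U : Set (ℝ × ℝ)} {w : ℝ × ℝ} (h : w ∉ U) : ind U w = 0 := by simp [ind, h]

lemma cnt_add (U : Set (ℝ × ℝ)) (a b : ℕ) (w : ℝ × ℝ) :
    cnt U (a + b) w = cnt U a w + cnt U b (bakerMap^[a] w) := by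
  unfold cnt
  rw [Finset.sum_range_add]
  congr 1
  refine Finset.sum_congr rfl fun i _ => ?_
  rw [← Function.iterate_add_apply, add_comm i a]

lemma cnt_succ (U : Set (ℝ × ℝ)) (n : ℕ) (w : ℝ × ℝ) :
    cnt U (n + 1) w = ind U w + cnt U n (bakerMap w) := by
  rw [add_comm n 1, cnt_add]
  simp [cnt]

lemma measurable_ind {U : Set (ℝ × ℝ)} (hU : MeasurableSet U) : Measurable (ind U) :=
  measurable_const.indicator hU

lemma measurable_cnt {U : Set (ℝ × ℝ)} (hU : MeasurableSet U) (n : ℕ) : Measurable (cnt U n) := by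
  unfold cnt
  exact Finset.measurable_fun_sum _ fun i _ => (measurable_ind hU).comp (measurable_iter i)

lemma meas_pow_cnt (s : ℂ) {U : Set (ℝ × ℝ)} (hU : MeasurableSet U) (n : ℕ) :
    StronglyMeasurable fun w => s ^ (cnt U n w) :=
  ((measurable_from_nat (f := fun k : ℕ => s ^ k)).comp (measurable_cnt hU n)).stronglyMeasurable

lemma norm_pow_one {s : ℂ} (hs : ‖s‖ = 1) (k : ℕ) : ‖s ^ k‖ = 1 := by rw [norm_pow, hs, one_pow]

lemma integrable_bdd {X : Type} [MeasurableSpace X] {μ : Measure X} [IsProbabilityMeasure μ]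
    {E : Type} [NormedAddCommGroup E] {f : X → E} (hf : StronglyMeasurable f) (C : ℝ)
    (hC : ∀ x, ‖f x‖ ≤ C) : Integrable f μ :=
  Integrable.of_bound hf.aestronglyMeasurable C (Eventually.of_forall hC)

lemma norm_FF_le {s : ℂ} (hs : ‖s‖ = 1) (U : Set (ℝ × ℝ)) (n : ℕ) : ‖FF s U n‖ ≤ 1 := by
  have := norm_integral_le_of_norm_le_const (μ := muQ) (f := fun w => s ^ (cnt U n w)) (C := 1)
    (Eventually.of_forall fun w => (norm_pow_one hs _).le)
  simpa [FF] using this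

/-- The return integral. -/
noncomputable def XX (s : ℂ) (U : Set (ℝ × ℝ)) (n : ℕ) : ℂ :=
  ∫ w, U.indicator (fun w => s ^ (cnt U n (bakerMap w))) w ∂muQ

lemma FF_succ {s : ℂ} (hs : ‖s‖ = 1) {U : Set (ℝ × ℝ)} (hU : MeasurableSet U) (n : ℕ) :
    FF s U (n + 1) = FF s U n + (s - 1) * XX s U n := by
  have hm : StronglyMeasurable fun w => s ^ (cnt U n (bakerMap w)) :=
    (meas_pow_cnt s hU n).comp_measurable measurable_baker
  have e1 : FF s U n = ∫ w, s ^ (cnt U n (bakerMap w)) ∂muQ := by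
    unfold FF
    exact (integral_comp_iter 1 (meas_pow_cnt s hU n)).symm
  rw [e1]
  unfold FF XX
  rw [← integral_const_mul, ← integral_add]
  · refine integral_congr_ae (Eventually.of_forall fun w => ?_)
    simp only
    rw [cnt_succ]
    by_cases hw : w ∈ U
    · rw [ind_of_mem hw, Set.indicator_of_mem hw]; ring
    · rw [ind_of_notMem hw, Set.indicator_of_notMem hw]; simp
  · exact integrable_bdd hm 1 fun w => (norm_pow_one hs _).le
  · refine Integrable.const_mul ?_ _
    refine integrable_bdd (hm.indicator hU) 1 fun w => ?_
    exact (norm_indicator_le_norm_self _ _).trans (norm_pow_one hs _).le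

lemma norm_XX_le {s : ℂ} (hs : ‖s‖ = 1) {U : Set (ℝ × ℝ)} (hU : MeasurableSet U) (n : ℕ) :
    ‖XX s U n‖ ≤ muQ.real U := by
  unfold XX
  rw [integral_indicator hU]
  have := norm_setIntegral_le_of_norm_le_const (μ := muQ) (s := U)
    (f := fun w => s ^ (cnt U n (bakerMap w))) (C := 1) (measure_lt_top _ _)
    (fun w _ => (norm_pow_one hs _).le)
  simpa using this

lemma norm_sub_one_le {s : ℂ} (hs : ‖s‖ = 1) : ‖s - 1‖ ≤ 2 :=
  (norm_sub_le _ _).trans (by rw [hs, norm_one]; norm_num)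

lemma FF_diff {s : ℂ} (hs : ‖s‖ = 1) {U : Set (ℝ × ℝ)} (hU : MeasurableSet U) (n m : ℕ) :
    ‖FF s U (n + m) - FF s U n‖ ≤ 2 * m * muQ.real U := by
  induction m with
  | zero => simp
  | succ m ih =>
    rw [← add_assoc, FF_succ hs hU]
    have h1 : ‖(s - 1) * XX s U (n + m)‖ ≤ 2 * muQ.real U := by
      rw [norm_mul]
      exact mul_le_mul (norm_sub_one_le hs) (norm_XX_le hs hU _) (norm_nonneg _) (by norm_num)
    have : FF s U (n + m) + (s - 1) * XX s U (n + m) - FF s U n =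
      (FF s U (n + m) - FF s U n) + (s - 1) * XX s U (n + m) := by ring
    rw [this]
    refine (norm_add_le _ _).trans ?_
    push_cast
    linarith

lemma pow_sub_one_le {s : ℂ} (hs : ‖s‖ = 1) (c : ℕ) : ‖s ^ c - 1‖ ≤ 2 * c := by
  rcases Nat.eq_zero_or_pos c with h | h
  · subst h; simp
  · have h1 := norm_sub_le (s ^ c) 1
    rw [norm_pow_one hs, norm_one] at h1
    have : (1:ℝ) ≤ c := by exact_mod_cast h
    linarith

lemma pow_sum_sub_le {s : ℂ} (hs : ‖s‖ = 1) (a b : ℕ → ℕ) (n : ℕ) :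
    ‖s ^ (∑ i ∈ Finset.range n, a i) - s ^ (∑ i ∈ Finset.range n, b i)‖ ≤
      ∑ i ∈ Finset.range n, (if a i = b i then (0:ℝ) else 2) := by
  induction n with
  | zero => simp
  | succ n ih =>
    rw [Finset.sum_range_succ, Finset.sum_range_succ, Finset.sum_range_succ, pow_add, pow_add]
    set A := ∑ i ∈ Finset.range n, a i
    set B := ∑ i ∈ Finset.range n, b i
    have e : s ^ A * s ^ (a n) - s ^ B * s ^ (b n) =
      (s ^ A - s ^ B) * s ^ (a n) + s ^ B * (s ^ (a n) - s ^ (b n)) := by ring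
    rw [e]
    refine (norm_add_le _ _).trans ?_
    rw [norm_mul, norm_mul, norm_pow_one hs, norm_pow_one hs, mul_one, one_mul]
    refine add_le_add ih ?_
    split_ifs with h
    · rw [h]; simp
    · refine (norm_sub_le _ _).trans ?_
      rw [norm_pow_one hs, norm_pow_one hs]; norm_num

/-! ### geometry of the ball -/

lemma sqball_eq (z : ℝ × ℝ) (r : ℝ) : Metric.ball z r =
    Set.Ioo (z.1 - r) (z.1 + r) ×ˢ Set.Ioo (z.2 - r) (z.2 + r) := by
  rw [← Real.ball_eq_Ioo, ← Real.ball_eq_Ioo, ball_prod_same]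

lemma int_J {E : Type} [NormedAddCommGroup E] [NormedSpace ℝ E] (g : ℝ → E) (a b : ℝ) (hab : a ≤ b)
    (ha : 0 ≤ a) (hb : b ≤ 1) :
    ∫ y, (Set.Ioo a b).indicator g y ∂nuU = ∫ y in a..b, g y := by
  rw [integral_indicator measurableSet_Ioo, intervalIntegral.integral_of_le hab,
    integral_Ioc_eq_integral_Ioo]
  unfold nuU
  rw [Measure.restrict_restrict measurableSet_Ioo, Set.inter_eq_left.2]
  intro y hy
  exact ⟨by linarith [hy.1], by linarith [hy.2]⟩

/-- the ball is inside the unit square -/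
def Inside (z : ℝ × ℝ) (r : ℝ) : Prop :=
  0 < r ∧ 0 ≤ z.1 - r ∧ z.1 + r ≤ 1 ∧ 0 ≤ z.2 - r ∧ z.2 + r ≤ 1

lemma mu_ball {z : ℝ × ℝ} {r : ℝ} (h : Inside z r) : muQ (Metric.ball z r) = ENNReal.ofReal (4 * r ^ 2) := by
  obtain ⟨h0, h1, h2, h3, h4⟩ := h
  have hI : ∀ a b : ℝ, 0 ≤ a → b ≤ 1 → nuU (Set.Ioo a b) = ENNReal.ofReal (b - a) := by
    intro a b ha hb
    unfold nuU
    rw [Measure.restrict_apply measurableSet_Ioo, Set.inter_eq_left.2, Real.volume_Ioo]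
    intro y hy
    exact ⟨by linarith [hy.1], by linarith [hy.2]⟩
  rw [sqball_eq, muQ, Measure.prod_prod, hI _ _ h1 h2, hI _ _ h3 h4, ← ENNReal.ofReal_mul (by linarith)]
  congr 1; ring

lemma mu_ball_real {z : ℝ × ℝ} {r : ℝ} (h : Inside z r) : muQ.real (Metric.ball z r) = 4 * r ^ 2 := by
  rw [Measure.real, mu_ball h, ENNReal.toReal_ofReal (by positivity)]

lemma measU (z : ℝ × ℝ) (r : ℝ) : MeasurableSet (Metric.ball z r) := Metric.isOpen_ball.measurableSet

lemma ae_Ico : ∀ᵐ w ∂muQ, w.1 ∈ Set.Ico (0:ℝ) 1 ∧ w.2 ∈ Set.Ico (0:ℝ) 1 := by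
  rw [muQ_eq_restrict]
  filter_upwards [ae_restrict_mem (measurableSet_Ico.prod measurableSet_Ico)] with w hw
  exact hw

lemma return_le {z : ℝ × ℝ} {r : ℝ} (h : Inside z r) (j : ℕ) :
    ∫ w, ((ind (Metric.ball z r) w : ℝ) * (ind (Metric.ball z r) (bakerMap^[j] w) : ℝ)) ∂muQ ≤
      4 * r ^ 2 * (2 * r + 1 / 2 ^ j) := by
  obtain ⟨h0, h1, h2, h3, h4⟩ := h
  set I := Set.Ioo (z.1 - r) (z.1 + r) with hI
  set J := Set.Ioo (z.2 - r) (z.2 + r) with hJ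
  let ψ : ℝ → ℝ := J.indicator (fun _ => (1:ℝ))
  have hψm : StronglyMeasurable ψ := stronglyMeasurable_const.indicator measurableSet_Ioo
  have hψ0 : ∀ y, 0 ≤ ψ y := fun y => Set.indicator_nonneg (fun _ _ => zero_le_one) y
  have hψ1 : ∀ y, ψ y ≤ 1 := fun y => Set.indicator_le_self' (fun _ _ => zero_le_one) y
  let G : ℝ → ℝ := J.indicator (fun y => ψ (Int.fract (2 ^ j * y)))
  have hGm : StronglyMeasurable G :=
    (hψm.comp_measurable (measurable_fract.comp (measurable_const_mul _))).indicator measurableSet_Ioo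
  have hG1 : ∀ y, ‖G y‖ ≤ 1 := fun y => by
    refine (norm_indicator_le_norm_self _ _).trans ?_
    rw [Real.norm_eq_abs, abs_of_nonneg (hψ0 _)]; exact hψ1 _
  have hG0 : ∀ y, 0 ≤ G y := fun y => Set.indicator_nonneg (fun _ _ => hψ0 _) y
  let X : ℝ → ℝ := I.indicator (fun _ => (1:ℝ))
  have hXm : StronglyMeasurable X := stronglyMeasurable_const.indicator measurableSet_Ioo
  have hX0 : ∀ y, 0 ≤ X y := fun y => Set.indicator_nonneg (fun _ _ => zero_le_one) y
  have hX1 : ∀ y, X y ≤ 1 := fun y => Set.indicator_le_self' (fun _ _ => zero_le_one) y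
  have hprod : ∫ w, X w.1 * G w.2 ∂muQ = (∫ x, X x ∂nuU) * ∫ y, G y ∂nuU := by
    unfold muQ; exact integral_prod_mul X G
  have hXi : ∫ x, X x ∂nuU = 2 * r := by
    simp only [X, hI]
    rw [int_J _ _ _ (by linarith) h1 h2]; simp; ring
  have hψi : ∫ x, ψ x ∂nuU = 2 * r := by
    simp only [ψ, hJ]
    rw [int_J _ _ _ (by linarith) h3 h4]; simp; ring
  have hGi : ∫ y, G y ∂nuU ≤ (2 * r + 1 / 2 ^ j) * (2 * r) := by
    simp only [G]
    rw [hJ, int_J _ _ _ (by linarith) h3 h4]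
    have := upper ψ hψm hψ0 hψ1 (z.2 - r) (z.2 + r) (by linarith) j
    rw [hψi] at this
    refine this.trans (le_of_eq ?_)
    ring
  have hle : ∫ w, ((ind (Metric.ball z r) w : ℝ) * (ind (Metric.ball z r) (bakerMap^[j] w) : ℝ)) ∂muQ
      ≤ ∫ w, X w.1 * G w.2 ∂muQ := by
    refine integral_mono_of_nonneg (Eventually.of_forall fun w => by positivity) ?_ ?_
    · refine integrable_bdd ((hXm.comp_measurable measurable_fst).mul
        (hGm.comp_measurable measurable_snd)) 1 fun w => ?_
      change ‖X w.1 * G w.2‖ ≤ 1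
      rw [norm_mul, Real.norm_eq_abs (X _), abs_of_nonneg (hX0 _)]
      exact mul_le_one₀ (hX1 _) (norm_nonneg _) (hG1 _)
    · filter_upwards [ae_Ico] with w hw
      by_cases hwU : w ∈ Metric.ball z r
      · by_cases hwU2 : bakerMap^[j] w ∈ Metric.ball z r
        · rw [ind_of_mem hwU, ind_of_mem hwU2]
          rw [sqball_eq] at hwU hwU2
          have e2 := snd_iter j w hw.2
          have hw2 : (bakerMap^[j] w).2 ∈ J := hwU2.2
          rw [e2] at hw2
          simp only [X, G, ψ]
          rw [Set.indicator_of_mem hwU.1, Set.indicator_of_mem hwU.2, Set.indicator_of_mem hw2]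
          norm_num
        · rw [ind_of_notMem hwU2]
          simpa using mul_nonneg (hX0 w.1) (hG0 w.2)
      · rw [ind_of_notMem hwU]
        simpa using mul_nonneg (hX0 w.1) (hG0 w.2)
  rw [hprod, hXi] at hle
  refine hle.trans ?_
  have := mul_le_mul_of_nonneg_left hGi (by linarith : 0 ≤ 2 * r)
  refine this.trans (le_of_eq ?_)
  ring

lemma strip_le (c r ε : ℝ) (hε : 0 ≤ ε) :
    muQ.real {q : ℝ × ℝ | |(|q.1 - c| - r)| ≤ ε} ≤ 4 * ε := by
  have hsub : {q : ℝ × ℝ | |(|q.1 - c| - r)| ≤ ε} ⊆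
      (Set.Icc (c + r - ε) (c + r + ε) ∪ Set.Icc (c - r - ε) (c - r + ε)) ×ˢ Set.univ := by
    intro q hq
    simp only [Set.mem_ofPred_eq] at hq
    rw [abs_le] at hq
    refine ⟨?_, trivial⟩
    rcases abs_cases (q.1 - c) with ⟨h, _⟩ | ⟨h, _⟩
    · left; rw [h] at hq; exact ⟨by linarith [hq.1], by linarith [hq.2]⟩
    · right; rw [h] at hq; exact ⟨by linarith [hq.2], by linarith [hq.1]⟩
  have hm : muQ {q : ℝ × ℝ | |(|q.1 - c| - r)| ≤ ε} ≤ ENNReal.ofReal (4 * ε) := by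
    refine (measure_mono hsub).trans ?_
    rw [muQ, Measure.prod_prod, measure_univ, mul_one]
    refine (Measure.restrict_apply_le _ _).trans ?_
    refine (measure_union_le _ _).trans ?_
    rw [Real.volume_Icc, Real.volume_Icc, ← ENNReal.ofReal_add (by linarith) (by linarith)]
    refine ENNReal.ofReal_le_ofReal ?_
    linarith
  exact ENNReal.toReal_le_of_le_ofReal (by linarith) hm

lemma fst_indep {s : ℂ} (hs : ‖s‖ = 1) (z : ℝ × ℝ) (r : ℝ) (n M : ℕ) :
    ∫ w, ‖s ^ (cnt (Metric.ball z r) n (bakerMap^[M] w)) -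
      s ^ (cnt (Metric.ball z r) n (bakerMap^[M] (0, w.2)))‖ ∂muQ ≤ 16 / 2 ^ M := by
  let S : ℕ → Set (ℝ × ℝ) := fun j => {q : ℝ × ℝ | |(|q.1 - z.1| - r)| ≤ 1 / 2 ^ j}
  have hS : ∀ j, MeasurableSet (S j) := fun j =>
    measurableSet_le (by fun_prop) measurable_const
  let f : ℕ → ℝ × ℝ → ℝ := fun i w => (S (M + i)).indicator (fun _ => (2:ℝ)) (bakerMap^[M + i] w)
  have hfm : ∀ i, StronglyMeasurable (f i) := fun i =>
    (stronglyMeasurable_const.indicator (hS _)).comp_measurable (measurable_iter _)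
  have hfi : ∀ i, Integrable (f i) muQ := fun i => by
    refine integrable_bdd (hfm i) 2 fun w => ?_
    refine (norm_indicator_le_norm_self _ _).trans ?_
    norm_num
  have hle : ∫ w, ‖s ^ (cnt (Metric.ball z r) n (bakerMap^[M] w)) -
      s ^ (cnt (Metric.ball z r) n (bakerMap^[M] (0, w.2)))‖ ∂muQ ≤
      ∫ w, ∑ i ∈ Finset.range n, f i w ∂muQ := by
    refine integral_mono_of_nonneg (Eventually.of_forall fun w => norm_nonneg _)
      (integrable_finsetSum _ fun i _ => hfi i) ?_
    filter_upwards [ae_Ico] with w hw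
    unfold cnt
    refine (pow_sum_sub_le hs _ _ n).trans ?_
    refine Finset.sum_le_sum fun i _ => ?_
    rw [← Function.iterate_add_apply, ← Function.iterate_add_apply, add_comm i M]
    split_ifs with hh
    · exact Set.indicator_nonneg (fun _ _ => by norm_num) _
    · have hmem : bakerMap^[M + i] w ∈ S (M + i) := by
        by_contra hnot
        apply hh
        obtain ⟨d1, d2⟩ := iter_fst (M + i) w.1 0 w.2
        simp only [Prod.mk.eta, sub_zero] at d1 d2
        simp only [S, Set.mem_ofPred_eq, not_le] at hnot
        set u := bakerMap^[M + i] w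
        set v := bakerMap^[M + i] (0, w.2)
        have hd0 : 0 ≤ u.1 - v.1 := by rw [d1]; exact div_nonneg hw.1.1 (by positivity)
        have hd1 : u.1 - v.1 ≤ 1 / 2 ^ (M + i) := by
          rw [d1]; exact div_le_div_of_nonneg_right hw.1.2.le (by positivity)
        have : u ∈ Metric.ball z r ↔ v ∈ Metric.ball z r := by
          rw [sqball_eq, Set.mem_prod, Set.mem_prod, d2]
          have : u.1 ∈ Set.Ioo (z.1 - r) (z.1 + r) ↔ v.1 ∈ Set.Ioo (z.1 - r) (z.1 + r) := by
            have a1 : ∀ x : ℝ, x ∈ Set.Ioo (z.1 - r) (z.1 + r) ↔ |x - z.1| < r := by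
              intro x; rw [abs_lt, Set.mem_Ioo]
              constructor <;> rintro ⟨_, _⟩ <;> constructor <;> linarith
            rw [a1, a1]
            have a2 : |(|u.1 - z.1| - |v.1 - z.1|)| ≤ u.1 - v.1 := by
              refine (abs_abs_sub_abs_le_abs_sub _ _).trans ?_
              rw [show u.1 - z.1 - (v.1 - z.1) = u.1 - v.1 by ring, abs_of_nonneg hd0]
            rw [abs_le] at a2
            rcases lt_abs.1 hnot with h | h
            · constructor <;> intro h' <;> linarith [a2.1, a2.2]
            · constructor <;> intro h' <;> linarith [a2.1, a2.2]
          rw [this]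
        by_cases hu : u ∈ Metric.ball z r
        · rw [ind_of_mem hu, ind_of_mem (this.1 hu)]
        · rw [ind_of_notMem hu, ind_of_notMem (fun h => hu (this.2 h))]
      simp only [f]
      rw [Set.indicator_of_mem hmem]
  refine hle.trans ?_
  rw [integral_finsetSum _ fun i _ => hfi i]
  have hfval : ∀ i, ∫ w, f i w ∂muQ ≤ (8 / 2 ^ M) * (1 / 2) ^ i := by
    intro i
    simp only [f]
    rw [integral_comp_iter (M + i) (stronglyMeasurable_const.indicator (hS _)),
      integral_indicator_const _ (hS _)]
    have := strip_le z.1 r (1 / 2 ^ (M + i)) (by positivity)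
    simp only [smul_eq_mul]
    have e : (8 / 2 ^ M) * (1 / 2 : ℝ) ^ i = 4 * (1 / 2 ^ (M + i)) * 2 := by
      rw [pow_add, one_div_pow]; field_simp; norm_num
    rw [e]
    exact mul_le_mul_of_nonneg_right this (by norm_num)
  refine (Finset.sum_le_sum fun i _ => hfval i).trans ?_
  rw [← Finset.mul_sum]
  have hg : ∑ i ∈ Finset.range n, (1 / 2 : ℝ) ^ i ≤ 2 := sum_geometric_two_le n
  have := mul_le_mul_of_nonneg_left hg (by positivity : (0:ℝ) ≤ 8 / 2 ^ M)
  refine this.trans (le_of_eq ?_)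
  ring

/-! ### Part 4 : the main estimate -/

def acoef (s : ℂ) : ℕ → ℂ
  | 0 => 1
  | k + 1 => s ^ (k + 1) - s ^ k

lemma acoef_le {s : ℂ} (hs : ‖s‖ = 1) (k : ℕ) : ‖acoef s k‖ ≤ 2 := by
  cases k with
  | zero => simp [acoef]
  | succ k =>
    refine (norm_sub_le _ _).trans ?_
    rw [norm_pow_one hs, norm_pow_one hs]; norm_num

def Loc (z : ℝ × ℝ) (r : ℝ) (p K : ℕ) : Prop :=
  ∀ w ∈ Metric.ball z r, ∀ j ≤ K * p,
    (bakerMap^[j] w ∈ Metric.ball z r ↔ p ∣ j ∧ |w.2 - z.2| < r / 2 ^ j)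

noncomputable def bb (z : ℝ × ℝ) (r : ℝ) (p : ℕ) (y : ℝ) (k : ℕ) : ℕ :=
  if |y - z.2| < r / 2 ^ (k * p) then 1 else 0

lemma cnt_local {z : ℝ × ℝ} {r : ℝ} {p K : ℕ} (hp : 1 ≤ p) (hL : Loc z r p K) {w : ℝ × ℝ}
    (hw : w ∈ Metric.ball z r) (k : ℕ) (hk : k ≤ K) :
    cnt (Metric.ball z r) (k * p) (bakerMap w) = ∑ i ∈ Finset.range k, bb z r p w.2 (i + 1) := by
  induction k with
  | zero => simp [cnt]
  | succ k ih =>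
    rw [add_mul, one_mul, cnt_add, ih (by omega), Finset.sum_range_succ]
    congr 1
    obtain ⟨q, rfl⟩ : ∃ q, p = q + 1 := ⟨p - 1, by omega⟩
    have hle : (k + 1) * (q + 1) ≤ K * (q + 1) := Nat.mul_le_mul_right _ hk
    have hexp : (k + 1) * (q + 1) = k * (q + 1) + (q + 1) := by ring
    unfold cnt
    rw [Finset.sum_range_succ]
    have hz : ∑ i ∈ Finset.range q,
        ind (Metric.ball z r) (bakerMap^[i] (bakerMap^[k * (q + 1)] (bakerMap w))) = 0 := by
      refine Finset.sum_eq_zero fun i hi => ?_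
      rw [Finset.mem_range] at hi
      refine ind_of_notMem ?_
      rw [← Function.iterate_add_apply, ← Function.iterate_succ_apply,
        hL w hw _ (by rw [Nat.succ_eq_add_one]; omega)]
      rintro ⟨h, -⟩
      have h' : (i + k * (q + 1)).succ = k * (q + 1) + (i + 1) := by rw [Nat.succ_eq_add_one]; omega
      rw [h', Nat.dvd_add_right (Dvd.intro_left _ rfl)] at h
      have := Nat.le_of_dvd (by omega) h
      omega
    rw [hz, zero_add, ← Function.iterate_add_apply, ← Function.iterate_succ_apply]
    have h' : (q + k * (q + 1)).succ = (k + 1) * (q + 1) := by rw [Nat.succ_eq_add_one]; omega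
    rw [h']
    have := hL w hw _ hle
    unfold bb
    split_ifs with hh
    · exact ind_of_mem (this.2 ⟨Dvd.intro_left _ rfl, hh⟩)
    · exact ind_of_notMem fun h => hh (this.1 h).2

lemma bb_mono {z : ℝ × ℝ} {r : ℝ} (hr : 0 < r) {p : ℕ} {y : ℝ} {i k : ℕ} (hik : i ≤ k)
    (h : bb z r p y k = 1) : bb z r p y i = 1 := by
  unfold bb at *
  split_ifs at h with h1
  rw [if_pos]
  refine h1.trans_le ?_
  refine div_le_div_of_nonneg_left hr.le (by positivity) ?_
  exact pow_le_pow_right₀ (by norm_num) (Nat.mul_le_mul_right _ hik)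

lemma pow_bb (s : ℂ) {z : ℝ × ℝ} {r : ℝ} (hr : 0 < r) (p : ℕ) (y : ℝ) (K : ℕ) :
    s ^ (∑ i ∈ Finset.range K, bb z r p y (i + 1)) =
      1 + ∑ i ∈ Finset.range K, acoef s (i + 1) * (bb z r p y (i + 1) : ℂ) := by
  induction K with
  | zero => simp
  | succ K ih =>
    rw [Finset.sum_range_succ, Finset.sum_range_succ]
    by_cases h : bb z r p y (K + 1) = 1
    · have e : ∑ i ∈ Finset.range K, bb z r p y (i + 1) = K := by
        rw [Finset.sum_congr rfl (g := fun _ => 1)]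
        · simp
        · intro i hi
          rw [Finset.mem_range] at hi
          exact bb_mono hr (by omega) h
      rw [← add_assoc, ← ih, e, h]
      simp [acoef]
    · have h0 : bb z r p y (K + 1) = 0 := by
        unfold bb at *; split_ifs at * <;> simp_all
      rw [h0, add_zero, ih]; simp

noncomputable def Jk (z : ℝ × ℝ) (r : ℝ) (p k : ℕ) : Set ℝ :=
  Set.Ioo (z.2 - r / 2 ^ (k * p)) (z.2 + r / 2 ^ (k * p))

noncomputable def phi (s : ℂ) (z : ℝ × ℝ) (r : ℝ) (p K : ℕ) (y : ℝ) : ℂ :=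
  ∑ k ∈ Finset.range (K + 1), acoef s k * (Jk z r p k).indicator (fun _ => (1:ℂ)) y

lemma Jk_bb (z : ℝ × ℝ) (r : ℝ) (p k : ℕ) (y : ℝ) :
    (Jk z r p k).indicator (fun _ => (1:ℂ)) y = (bb z r p y k : ℂ) := by
  have : y ∈ Jk z r p k ↔ |y - z.2| < r / 2 ^ (k * p) := by
    unfold Jk; rw [abs_lt, Set.mem_Ioo]
    constructor <;> rintro ⟨_, _⟩ <;> constructor <;> linarith
  unfold bb
  by_cases h : y ∈ Jk z r p k
  · rw [Set.indicator_of_mem h, if_pos (this.1 h)]; simp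
  · rw [Set.indicator_of_notMem h, if_neg (fun h' => h (this.2 h'))]; simp

lemma phi_eq (s : ℂ) {z : ℝ × ℝ} {r : ℝ} (hr : 0 < r) {p K : ℕ} (hp : 1 ≤ p) (hL : Loc z r p K)
    {w : ℝ × ℝ} (hw : w ∈ Metric.ball z r) :
    s ^ (cnt (Metric.ball z r) (K * p) (bakerMap w)) = phi s z r p K w.2 := by
  rw [cnt_local hp hL hw K le_rfl, pow_bb s hr, phi, Finset.sum_range_succ', add_comm]
  simp only [Jk_bb]
  congr 1
  have : bb z r p w.2 0 = 1 := by
    unfold bb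
    rw [if_pos]
    rw [sqball_eq] at hw
    have := hw.2
    rw [Set.mem_Ioo] at this
    simp only [zero_mul, pow_zero, div_one]
    rw [abs_lt]; constructor <;> linarith
  rw [this]; simp [acoef]

lemma phi_eq_zero (s : ℂ) {z : ℝ × ℝ} {r : ℝ} (hr : 0 < r) {p K : ℕ}
    {y : ℝ} (hy : y ∉ Set.Ioo (z.2 - r) (z.2 + r)) : phi s z r p K y = 0 := by
  unfold phi
  refine Finset.sum_eq_zero fun k _ => ?_
  rw [Set.indicator_of_notMem, mul_zero]
  intro h
  apply hy
  have : r / 2 ^ (k * p) ≤ r := div_le_self hr.le (one_le_pow₀ (by norm_num))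
  exact ⟨by linarith [h.1], by linarith [h.2]⟩

/-- truncated return transform -/
noncomputable def gK (s : ℂ) (p K : ℕ) : ℂ :=
  ∑ k ∈ Finset.range (K + 1), acoef s k * (1 / 2 ^ (k * p))

lemma gK_le {s : ℂ} (hs : ‖s‖ = 1) (p K : ℕ) : ‖gK s p K‖ ≤ 2 * (K + 1) := by
  unfold gK
  refine (norm_sum_le_of_le (n := fun _ => (2:ℝ)) _ fun k _ => ?_).trans ?_
  · rw [norm_mul]
    have h2 : ‖(1 / 2 ^ (k * p) : ℂ)‖ ≤ 1 := by
      rw [norm_div, norm_one, norm_pow]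
      refine div_le_one_of_le₀ ?_ (by positivity)
      exact one_le_pow₀ (by simp)
    have := mul_le_mul (acoef_le hs k) h2 (norm_nonneg _) (by norm_num)
    simpa using this
  · simp; linarith

lemma main_Z {s : ℂ} (hs : ‖s‖ = 1) {z : ℝ × ℝ} {r : ℝ} (h : Inside z r) (p K M : ℕ)
    (ψ : ℝ → ℂ) (hm : StronglyMeasurable ψ) (hb : ∀ y, ‖ψ y‖ ≤ 1) :
    ‖(∫ w, (Set.Ioo (z.1 - r) (z.1 + r)).indicator (fun _ => (1:ℂ)) w.1 *
        (phi s z r p K w.2 * ψ (Int.fract (2 ^ M * w.2))) ∂muQ) -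
      4 * r ^ 2 * gK s p K * ∫ y, ψ y ∂nuU‖ ≤ 8 * r * (K + 1) / 2 ^ M := by
  obtain ⟨h0, h1, h2, h3, h4⟩ := h
  have hprod := integral_prod_mul (μ := nuU) (ν := nuU)
    ((Set.Ioo (z.1 - r) (z.1 + r)).indicator (fun _ => (1:ℂ)))
    (fun y => phi s z r p K y * ψ (Int.fract (2 ^ M * y)))
  unfold muQ
  rw [hprod, int_J _ _ _ (by linarith) h1 h2]
  have e1 : ∫ y in (z.1 - r)..(z.1 + r), (1:ℂ) = 2 * r := by
    simp; ring
  rw [e1]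
  have hgm : StronglyMeasurable (fun y : ℝ => ψ (Int.fract (2 ^ M * y))) :=
    hm.comp_measurable (measurable_fract.comp (measurable_const_mul _))
  have e2 : ∫ y, phi s z r p K y * ψ (Int.fract (2 ^ M * y)) ∂nuU =
      ∑ k ∈ Finset.range (K + 1), acoef s k *
        ∫ y in (z.2 - r / 2 ^ (k * p))..(z.2 + r / 2 ^ (k * p)), ψ (Int.fract (2 ^ M * y)) := by
    have : ∀ y, phi s z r p K y * ψ (Int.fract (2 ^ M * y)) =
        ∑ k ∈ Finset.range (K + 1), acoef s k *
          (Jk z r p k).indicator (fun y => ψ (Int.fract (2 ^ M * y))) y := by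
      intro y
      unfold phi
      rw [Finset.sum_mul]
      refine Finset.sum_congr rfl fun k _ => ?_
      by_cases hy : y ∈ Jk z r p k
      · rw [Set.indicator_of_mem hy, Set.indicator_of_mem hy]; ring
      · rw [Set.indicator_of_notMem hy, Set.indicator_of_notMem hy]; ring
    simp_rw [this]
    rw [integral_finsetSum]
    · refine Finset.sum_congr rfl fun k _ => ?_
      rw [integral_const_mul]
      congr 1
      have hk0 : 0 < r / 2 ^ (k * p) := by positivity
      have hk1 : r / 2 ^ (k * p) ≤ r := div_le_self h0.le (one_le_pow₀ (by norm_num))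
      exact int_J _ _ _ (by linarith) (by linarith) (by linarith)
    · intro k _
      refine Integrable.const_mul ?_ _
      refine integrable_bdd (hgm.indicator measurableSet_Ioo) 1 fun y => ?_
      exact (norm_indicator_le_norm_self _ _).trans (hb _)
  rw [e2]
  set Iψ := ∫ y, ψ y ∂nuU
  have e3 : 2 * (r:ℂ) * (∑ k ∈ Finset.range (K + 1), acoef s k *
        ∫ y in (z.2 - r / 2 ^ (k * p))..(z.2 + r / 2 ^ (k * p)), ψ (Int.fract (2 ^ M * y))) -
        4 * r ^ 2 * gK s p K * Iψ = ∑ k ∈ Finset.range (K + 1), (2 * (r:ℂ)) * (acoef s k *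
        ((∫ y in (z.2 - r / 2 ^ (k * p))..(z.2 + r / 2 ^ (k * p)), ψ (Int.fract (2 ^ M * y))) -
          (((z.2 + r / 2 ^ (k * p) : ℝ) : ℂ) - ((z.2 - r / 2 ^ (k * p) : ℝ) : ℂ)) * Iψ)) := by
    unfold gK
    rw [Finset.mul_sum, Finset.mul_sum, Finset.sum_mul, ← Finset.sum_sub_distrib]
    refine Finset.sum_congr rfl fun k _ => ?_
    push_cast
    ring
  rw [e3]
  refine (norm_sum_le_of_le (n := fun _ => 2 * r * (2 * (2 / 2 ^ M))) _ fun k _ => ?_).trans ?_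
  · rw [norm_mul, norm_mul (acoef s k)]
    have : ‖(2 * (r:ℂ))‖ = 2 * r := by
      rw [norm_mul, Complex.norm_real, Real.norm_eq_abs, abs_of_pos h0]; simp
    rw [this]
    refine mul_le_mul_of_nonneg_left ?_ (by linarith)
    exact mul_le_mul (acoef_le hs k) (decorr ψ hm hb _ _ M) (norm_nonneg _) (by norm_num)
  · rw [Finset.sum_const, Finset.card_range, nsmul_eq_mul]
    push_cast
    refine le_of_eq ?_
    ring

lemma measurable_mk0 : Measurable (fun y : ℝ => ((0:ℝ), y)) := by fun_prop

lemma main_est {s : ℂ} (hs : ‖s‖ = 1) {z : ℝ × ℝ} {r : ℝ} (h : Inside z r) {p K M d n' : ℕ}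
    (hp : 1 ≤ p) (hL : Loc z r p K) (hd : K * p + 1 + d = 2 * M) (g : ℂ) :
    ‖XX s (Metric.ball z r) (K * p + d + n') -
        4 * r ^ 2 * g * FF s (Metric.ball z r) (K * p + d + n')‖ ≤
      4 * r ^ 2 * (8 * r * M + 2 / 2 ^ (K * p)) + 16 / 2 ^ M + 8 * r * (K + 1) / 2 ^ M +
      4 * r ^ 2 * (2 * (K + 1) * (16 / 2 ^ M + 16 * r ^ 2 * M)) + 4 * r ^ 2 * ‖gK s p K - g‖ := by
  have hr := h.1
  have hmu := mu_ball_real h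
  have hL' := hL
  set U := Metric.ball z r with hUdef
  have hU : MeasurableSet U := measU z r
  set I := Set.Ioo (z.1 - r) (z.1 + r) with hI
  -- functions
  let c2 : ℝ × ℝ → ℕ := fun w => cnt U d (bakerMap^[K * p + 1] w)
  let c3 : ℝ × ℝ → ℕ := fun w => cnt U n' (bakerMap^[2 * M] w)
  let Φ : ℝ × ℝ → ℂ := fun w => I.indicator (fun _ => (1:ℂ)) w.1 * phi s z r p K w.2
  have hΦ : ∀ w, Φ w = U.indicator (fun w => s ^ cnt U (K * p) (bakerMap w)) w := by
    intro w
    by_cases hw : w ∈ U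
    · rw [Set.indicator_of_mem hw, phi_eq s hr hp hL' hw]
      have : w.1 ∈ I := by
        have h' := hw
        rw [hUdef, sqball_eq] at h'; exact h'.1
      simp only [Φ]
      rw [Set.indicator_of_mem this, one_mul]
    · rw [Set.indicator_of_notMem hw]
      simp only [Φ]
      by_cases h1 : w.1 ∈ I
      · rw [phi_eq_zero s hr, mul_zero]
        intro h2
        exact hw (by rw [hUdef, sqball_eq]; exact ⟨h1, h2⟩)
      · rw [Set.indicator_of_notMem h1, zero_mul]
  have hΦm : StronglyMeasurable Φ := by
    have : Φ = U.indicator (fun w => s ^ cnt U (K * p) (bakerMap w)) := funext hΦ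
    rw [this]
    exact ((meas_pow_cnt s hU _).comp_measurable measurable_baker).indicator hU
  have hΦ1 : ∀ w, ‖Φ w‖ ≤ 1 := fun w => by
    rw [hΦ]; exact (norm_indicator_le_norm_self _ _).trans (norm_pow_one hs _).le
  have hc3m : StronglyMeasurable fun w => s ^ c3 w :=
    (meas_pow_cnt s hU n').comp_measurable (measurable_iter _)
  have hc2m : StronglyMeasurable fun w => s ^ c2 w :=
    (meas_pow_cnt s hU d).comp_measurable (measurable_iter _)
  have hX : XX s U (K * p + d + n') = ∫ w, Φ w * s ^ c2 w * s ^ c3 w ∂muQ := by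
    unfold XX
    refine integral_congr_ae (Eventually.of_forall fun w => ?_)
    simp only
    rw [hΦ]
    by_cases hw : w ∈ U
    · rw [Set.indicator_of_mem hw, Set.indicator_of_mem hw, ← pow_add, ← pow_add]
      congr 1
      rw [cnt_add, cnt_add]
      simp only [c2, c3]
      rw [← hd, ← Function.iterate_succ_apply, ← Function.iterate_succ_apply]
      congr 2
      rw [Nat.succ_eq_add_one]; congr 1; omega
    · rw [Set.indicator_of_notMem hw, Set.indicator_of_notMem hw]; simp
  -- step 1
  have hi1 : Integrable (fun w => Φ w * s ^ c2 w * s ^ c3 w) muQ :=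
    integrable_bdd ((hΦm.mul hc2m).mul hc3m) 1 fun w => by
      simpa [norm_mul, hs] using hΦ1 w
  have hi2 : Integrable (fun w => Φ w * s ^ c3 w) muQ :=
    integrable_bdd (hΦm.mul hc3m) 1 fun w => by
      simpa [norm_mul, hs] using hΦ1 w
  have hretm : ∀ j, StronglyMeasurable fun w => (ind U w : ℝ) * (ind U (bakerMap^[j] w) : ℝ) := by
    intro j
    have m1 : Measurable fun w => (ind U w : ℝ) := measurable_from_nat.comp (measurable_ind hU)
    exact (m1.mul (m1.comp (measurable_iter j))).stronglyMeasurable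
  have hind1 : ∀ w, (ind U w : ℝ) ≤ 1 := by
    intro w
    by_cases hw : w ∈ U
    · rw [ind_of_mem hw]; simp
    · rw [ind_of_notMem hw]; simp
  have hreti : ∀ j, Integrable (fun w => (ind U w : ℝ) * (ind U (bakerMap^[j] w) : ℝ)) muQ := by
    intro j
    refine integrable_bdd (hretm j) 1 fun w => ?_
    rw [Real.norm_eq_abs, abs_of_nonneg (by positivity)]
    exact mul_le_one₀ (hind1 _) (by positivity) (hind1 _)
  have s1 : ‖(∫ w, Φ w * s ^ c2 w * s ^ c3 w ∂muQ) - ∫ w, Φ w * s ^ c3 w ∂muQ‖ ≤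
      4 * r ^ 2 * (8 * r * M + 2 / 2 ^ (K * p)) := by
    rw [← integral_sub hi1 hi2]
    have hbd : ‖∫ w, (Φ w * s ^ c2 w * s ^ c3 w - Φ w * s ^ c3 w) ∂muQ‖ ≤
        ∫ w, ∑ i ∈ Finset.range d, 2 * ((ind U w : ℝ) * (ind U (bakerMap^[K * p + 1 + i] w) : ℝ)) ∂muQ := by
      refine norm_integral_le_of_norm_le
        (integrable_finsetSum _ fun i _ => (hreti _).const_mul _) (Eventually.of_forall fun w => ?_)
      have e : Φ w * s ^ c2 w * s ^ c3 w - Φ w * s ^ c3 w = Φ w * (s ^ c2 w - 1) * s ^ c3 w := by ring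
      rw [e, norm_mul, norm_pow_one hs, mul_one, norm_mul, ← Finset.mul_sum, ← Finset.mul_sum]
      have hc : ∑ i ∈ Finset.range d, (ind U (bakerMap^[K * p + 1 + i] w) : ℝ) = (c2 w : ℝ) := by
        simp only [c2, cnt]
        push_cast
        refine Finset.sum_congr rfl fun i _ => ?_
        rw [← Function.iterate_add_apply, add_comm i]
      rw [hc]
      by_cases hw : w ∈ U
      · rw [ind_of_mem hw]
        have := mul_le_mul (hΦ1 w) (pow_sub_one_le hs (c2 w)) (norm_nonneg _) zero_le_one
        push_cast; linarith
      · rw [ind_of_notMem hw, hΦ, Set.indicator_of_notMem hw]; simp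
    refine hbd.trans ?_
    rw [integral_finsetSum _ fun i _ => (hreti _).const_mul _]
    have hterm : ∀ i ∈ Finset.range d, ∫ w, 2 * ((ind U w : ℝ) * (ind U (bakerMap^[K * p + 1 + i] w) : ℝ)) ∂muQ
        ≤ 4 * r ^ 2 * (4 * r + (1 / 2 ^ (K * p)) * (1 / 2) ^ i) := by
      intro i _
      rw [integral_const_mul]
      have := return_le h (K * p + 1 + i)
      have e : (1 / 2 ^ (K * p)) * (1 / 2 : ℝ) ^ i = 2 * (1 / 2 ^ (K * p + 1 + i)) := by
        rw [pow_add, pow_add, one_div_pow]; field_simp; try norm_num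
      rw [e]
      linarith
    refine (Finset.sum_le_sum hterm).trans ?_
    rw [← Finset.mul_sum, Finset.sum_add_distrib, ← Finset.mul_sum, Finset.sum_const,
      Finset.card_range, nsmul_eq_mul]
    refine mul_le_mul_of_nonneg_left ?_ (by positivity)
    have hg : ∑ i ∈ Finset.range d, (1 / 2 : ℝ) ^ i ≤ 2 := sum_geometric_two_le d
    have h1 := mul_le_mul_of_nonneg_left hg (by positivity : (0:ℝ) ≤ 1 / 2 ^ (K * p))
    have hdM : (d:ℝ) ≤ 2 * M := by
      have : d ≤ 2 * M := by omega
      exact_mod_cast this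
    have h2 : (d:ℝ) * (4 * r) ≤ 2 * M * (4 * r) := mul_le_mul_of_nonneg_right hdM (by linarith)
    have h3 : 1 / 2 ^ (K * p) * 2 = (2:ℝ) / 2 ^ (K * p) := by ring
    rw [Finset.mul_sum] at h1
    linarith
  -- step 2
  let H : ℝ × ℝ → ℂ := fun w => s ^ (cnt U n' (bakerMap^[M] w))
  let ψ : ℝ → ℂ := fun y => H (0, y)
  have hHm : StronglyMeasurable H := (meas_pow_cnt s hU n').comp_measurable (measurable_iter _)
  have hψm : StronglyMeasurable ψ := hHm.comp_measurable measurable_mk0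
  have hψb : ∀ y, ‖ψ y‖ ≤ 1 := fun y => (norm_pow_one hs _).le
  have hHb : ∀ y, ‖H y‖ ≤ 1 := fun y => (norm_pow_one hs _).le
  have hψsm : StronglyMeasurable fun w : ℝ × ℝ => ψ w.2 := hψm.comp_measurable measurable_snd
  have hdiffm : StronglyMeasurable fun w : ℝ × ℝ => ‖H w - ψ w.2‖ := (hHm.sub hψsm).norm
  have hdiffb : ∀ w : ℝ × ℝ, ‖‖H w - ψ w.2‖‖ ≤ 2 := fun w => by
    rw [norm_norm]
    exact (norm_sub_le _ _).trans (by linarith [hHb w, hψb w.2])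
  have hβ : ∫ w, ‖H w - ψ w.2‖ ∂muQ ≤ 16 / 2 ^ M := fst_indep hs z r n' M
  have hfr : StronglyMeasurable fun w : ℝ × ℝ => ψ (Int.fract (2 ^ M * w.2)) :=
    hψm.comp_measurable (measurable_fract.comp (measurable_snd.const_mul _))
  have hi3 : Integrable (fun w => Φ w * ψ (Int.fract (2 ^ M * w.2))) muQ :=
    integrable_bdd (hΦm.mul hfr) 1 fun w => by
      rw [norm_mul]; exact mul_le_one₀ (hΦ1 w) (norm_nonneg _) (hψb _)
  have s2 : ‖(∫ w, Φ w * s ^ c3 w ∂muQ) - ∫ w, Φ w * ψ (Int.fract (2 ^ M * w.2)) ∂muQ‖ ≤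
      16 / 2 ^ M := by
    rw [← integral_sub hi2 hi3]
    refine le_trans ?_ hβ
    rw [← integral_comp_iter M hdiffm]
    refine norm_integral_le_of_norm_le ?_ ?_
    · exact integrable_bdd (hdiffm.comp_measurable (measurable_iter M)) 2 fun w => hdiffb _
    · filter_upwards [ae_Ico] with w hw
      rw [← mul_sub, norm_mul, ← snd_iter M w hw.2]
      have e : s ^ c3 w = H (bakerMap^[M] w) := by
        simp only [c3, H]
        rw [← Function.iterate_add_apply, two_mul]
      rw [e]
      exact mul_le_of_le_one_left (norm_nonneg _) (hΦ1 w)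
  -- step 3
  have s3 := main_Z hs h p K M ψ hψm hψb
  have e3 : ∫ w, Φ w * ψ (Int.fract (2 ^ M * w.2)) ∂muQ =
    ∫ w, (Set.Ioo (z.1 - r) (z.1 + r)).indicator (fun _ => (1:ℂ)) w.1 *
        (phi s z r p K w.2 * ψ (Int.fract (2 ^ M * w.2))) ∂muQ := by
    refine integral_congr_ae (Eventually.of_forall fun w => ?_)
    simp only [Φ, hI, mul_assoc]
  rw [← e3] at s3
  -- step 4
  have s4 : ‖(∫ y, ψ y ∂nuU) - FF s U n'‖ ≤ 16 / 2 ^ M := by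
    have e4 : ∫ y, ψ y ∂nuU = ∫ w, ψ w.2 ∂muQ := by
      have := integral_prod_mul (μ := nuU) (ν := nuU) (fun _ => (1:ℂ)) ψ
      simp only [one_mul] at this
      unfold muQ; rw [this]; simp
    have e5 : FF s U n' = ∫ w, H w ∂muQ := by
      unfold FF
      exact (integral_comp_iter M (meas_pow_cnt s hU n')).symm
    rw [e4, e5, norm_sub_rev, ← integral_sub (integrable_bdd hHm 1 hHb)
      (integrable_bdd hψsm 1 fun w => hψb _)]
    exact (norm_integral_le_integral_norm _).trans hβ
  have s5 : ‖FF s U n' - FF s U (K * p + d + n')‖ ≤ 16 * r ^ 2 * M := by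
    rw [norm_sub_rev, add_comm]
    refine (FF_diff hs hU n' (K * p + d)).trans ?_
    rw [hmu]
    have : ((K * p + d : ℕ) : ℝ) ≤ 2 * M := by
      have : K * p + d ≤ 2 * M := by omega
      exact_mod_cast this
    have := mul_le_mul_of_nonneg_right this (by positivity : (0:ℝ) ≤ 8 * r ^ 2)
    linarith
  set A0 := XX s U (K * p + d + n')
  set A1 := ∫ w, Φ w * s ^ c3 w ∂muQ
  set A2 := ∫ w, Φ w * ψ (Int.fract (2 ^ M * w.2)) ∂muQ
  set A3 := ∫ y, ψ y ∂nuU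
  set A4 := FF s U n'
  set A5 := FF s U (K * p + d + n') with hA5
  rw [← hX] at s1
  have hA5n : ‖A5‖ ≤ 1 := norm_FF_le hs _ _
  have hr2 : ‖(4 * (r:ℂ) ^ 2)‖ = 4 * r ^ 2 := by
    rw [norm_mul, norm_pow, Complex.norm_real, Real.norm_eq_abs, abs_of_pos hr]; simp
  have hdec : A0 - 4 * r ^ 2 * g * A5 = (A0 - A1) + (A1 - A2) + (A2 - 4 * r ^ 2 * gK s p K * A3) +
      4 * r ^ 2 * (gK s p K * ((A3 - A4) + (A4 - A5))) + 4 * r ^ 2 * ((gK s p K - g) * A5) := by ring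
  rw [hdec]
  have n4 : ‖4 * (r:ℂ) ^ 2 * (gK s p K * ((A3 - A4) + (A4 - A5)))‖ ≤
      4 * r ^ 2 * (2 * (K + 1) * (16 / 2 ^ M + 16 * r ^ 2 * M)) := by
    rw [norm_mul, hr2, norm_mul]
    refine mul_le_mul_of_nonneg_left ?_ (by positivity)
    exact mul_le_mul (gK_le hs p K) ((norm_add_le _ _).trans (add_le_add s4 s5)) (norm_nonneg _)
      (by positivity)
  have n5 : ‖4 * (r:ℂ) ^ 2 * ((gK s p K - g) * A5)‖ ≤ 4 * r ^ 2 * ‖gK s p K - g‖ := by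
    rw [norm_mul, hr2, norm_mul]
    refine mul_le_mul_of_nonneg_left ?_ (by positivity)
    exact mul_le_of_le_one_right (norm_nonneg _) hA5n
  refine (norm_add_le _ _).trans (add_le_add ?_ n5)
  refine (norm_add_le _ _).trans (add_le_add ?_ n4)
  refine (norm_add_le _ _).trans (add_le_add ?_ s3)
  exact (norm_add_le _ _).trans (add_le_add s1 s2)

/-! ### Part 5 : local structure -/

lemma iter_snd_int (z : ℝ × ℝ) (j : ℕ) : ∃ m : ℤ, (bakerMap^[j] z).2 = 2 ^ j * z.2 - m := by
  induction j with
  | zero => exact ⟨0, by simp⟩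
  | succ j ih =>
    obtain ⟨m, hm⟩ := ih
    rw [Function.iterate_succ_apply']
    unfold bakerMap at *
    split_ifs
    · refine ⟨2 * m, ?_⟩
      simp only; rw [hm]; push_cast; ring
    · refine ⟨2 * m + 1, ?_⟩
      simp only; rw [hm]; push_cast; ring

lemma iter_snd_ne {z : ℝ × ℝ} (hy : Nondyadic z.2) (j : ℕ) : (bakerMap^[j] z).2 ≠ 1 / 2 := by
  obtain ⟨m, hm⟩ := iter_snd_int z j
  rw [hm]
  intro h
  apply hy (2 * m + 1) (j + 1)
  rw [eq_div_iff (by positivity), pow_succ]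
  push_cast
  linarith

lemma iter_local {z : ℝ × ℝ} (hy : Nondyadic z.2) (j : ℕ) : ∃ δ > 0, ∀ w : ℝ × ℝ,
    |w.2 - z.2| < δ → (bakerMap^[j] w).1 = (bakerMap^[j] z).1 + (w.1 - z.1) / 2 ^ j ∧
      (bakerMap^[j] w).2 = (bakerMap^[j] z).2 + 2 ^ j * (w.2 - z.2) := by
  induction j with
  | zero => exact ⟨1, one_pos, fun w _ => by simp⟩
  | succ j ih =>
    obtain ⟨δ, hδ, ih⟩ := ih
    have hne := iter_snd_ne hy j
    set v := bakerMap^[j] z with hv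
    have hpos : 0 < |v.2 - 1 / 2| := abs_pos.2 (sub_ne_zero.2 hne)
    refine ⟨min δ (|v.2 - 1 / 2| / 2 ^ j), by positivity, fun w hw => ?_⟩
    obtain ⟨h1, h2⟩ := ih w (hw.trans_le (min_le_left _ _))
    have h3 := hw.trans_le (min_le_right _ _)
    rw [lt_div_iff₀ (by positivity)] at h3
    have h4 : |2 ^ j * (w.2 - z.2)| < |v.2 - 1 / 2| := by
      rw [abs_mul, abs_of_pos (by positivity : (0:ℝ) < 2 ^ j)]; linarith
    rw [Function.iterate_succ_apply', Function.iterate_succ_apply', ← hv]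
    have h5 := abs_lt.1 h4
    have hiff : (bakerMap^[j] w).2 < 1 / 2 ↔ v.2 < 1 / 2 := by
      rw [h2]
      rcases lt_or_gt_of_ne hne with h | h
      · rw [abs_of_neg (by linarith)] at h5
        exact ⟨fun _ => h, fun _ => by linarith [h5.2]⟩
      · rw [abs_of_pos (by linarith)] at h5
        exact ⟨fun _ => by linarith [h5.1], fun _ => by linarith⟩
    by_cases hc : v.2 < 1 / 2
    · unfold bakerMap at *
      rw [if_pos hc, if_pos (hiff.2 hc)]
      simp only
      rw [h1, h2, pow_succ]
      constructor <;> ring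
    · unfold bakerMap at *
      rw [if_neg hc, if_neg (fun h => hc (hiff.1 h))]
      simp only
      rw [h1, h2, pow_succ]
      constructor <;> ring

lemma mem_ball_iff (z w : ℝ × ℝ) (r : ℝ) :
    w ∈ Metric.ball z r ↔ |w.1 - z.1| < r ∧ |w.2 - z.2| < r := by
  rw [Metric.mem_ball, Prod.dist_eq, max_lt_iff, Real.dist_eq, Real.dist_eq]

lemma ev_small {δ : ℝ} (hδ : 0 < δ) : ∀ᶠ r : ℝ in 𝓝[>] 0, 0 < r ∧ r < δ := by
  filter_upwards [Ioo_mem_nhdsGT hδ] with r hr using hr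

lemma loc_ev {z : ℝ × ℝ} (hy : Nondyadic z.2) {p : ℕ} (hp : 1 ≤ p)
    (hper : bakerMap^[p] z = z) (hmin : ∀ j, 1 ≤ j → j < p → bakerMap^[j] z ≠ z) (K : ℕ) :
    ∀ᶠ r : ℝ in 𝓝[>] 0, Loc z r p K := by
  have key : ∀ j, ∀ᶠ r : ℝ in 𝓝[>] 0, ∀ w ∈ Metric.ball z r,
      (bakerMap^[j] w ∈ Metric.ball z r ↔ p ∣ j ∧ |w.2 - z.2| < r / 2 ^ j) := by
    intro j
    have hP : Function.IsPeriodicPt bakerMap p z := hper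
    obtain ⟨δ, hδ, hloc⟩ := iter_local hy j
    have h1j : (1:ℝ) ≤ 2 ^ j := one_le_pow₀ (by norm_num)
    by_cases hj : p ∣ j
    · have hz : bakerMap^[j] z = z := hP.trans_dvd hj
      filter_upwards [ev_small hδ] with r ⟨hr, hrd⟩ w hw
      rw [mem_ball_iff] at hw
      obtain ⟨e1, e2⟩ := hloc w (hw.2.trans hrd)
      rw [mem_ball_iff, e1, e2, hz, add_sub_cancel_left, add_sub_cancel_left, abs_div, abs_mul,
        abs_of_pos (by positivity : (0:ℝ) < 2 ^ j), lt_div_iff₀ (by positivity), mul_comm]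
      have : |w.1 - z.1| / 2 ^ j < r := (div_le_self (abs_nonneg _) h1j).trans_lt hw.1
      tauto
    · have hz : bakerMap^[j] z ≠ z := by
        rw [← hP.iterate_mod_apply j]
        exact hmin _ (Nat.pos_of_ne_zero fun h => hj (Nat.dvd_of_mod_eq_zero h))
          (Nat.mod_lt _ (by omega))
      have hD : 0 < dist (bakerMap^[j] z) z := dist_pos.2 hz
      filter_upwards [ev_small hδ, ev_small (δ := dist (bakerMap^[j] z) z / (2 ^ j + 1))
        (by positivity)] with r ⟨hr, hrd⟩ ⟨_, hrD⟩ w hw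
      rw [mem_ball_iff] at hw
      obtain ⟨e1, e2⟩ := hloc w (hw.2.trans hrd)
      refine iff_of_false (fun hm => ?_) (fun h => hj h.1)
      rw [lt_div_iff₀ (by positivity)] at hrD
      rw [Metric.mem_ball] at hm
      have hd : dist (bakerMap^[j] z) (bakerMap^[j] w) ≤ 2 ^ j * r := by
        rw [dist_comm, Prod.dist_eq, Real.dist_eq, Real.dist_eq, e1, e2, add_sub_cancel_left,
          add_sub_cancel_left, abs_div, abs_mul, abs_of_pos (by positivity : (0:ℝ) < 2 ^ j)]
        refine max_le ?_ (mul_le_mul_of_nonneg_left hw.2.le (by positivity))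
        refine (div_le_self (abs_nonneg _) h1j).trans ?_
        nlinarith [hw.1]
      have := dist_triangle (bakerMap^[j] z) (bakerMap^[j] w) z
      linarith
  have := (Finset.eventually_all (Finset.range (K * p + 1))).2 fun j _ => key j
  filter_upwards [this] with r hr w hw j hj
  exact hr j (Finset.mem_range.2 (by omega)) w hw

lemma inside_ev {z : ℝ × ℝ} (hz : z ∈ Set.Ioo (0:ℝ) 1 ×ˢ Set.Ioo (0:ℝ) 1) :
    ∀ᶠ r : ℝ in 𝓝[>] 0, Inside z r := by
  obtain ⟨⟨a, b⟩, c, d⟩ := hz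
  filter_upwards [ev_small a, ev_small c, ev_small (sub_pos.2 b), ev_small (sub_pos.2 d)] with
    r h1 h2 h3 h4
  exact ⟨h1.1, by linarith, by linarith, by linarith, by linarith⟩

lemma gK_tendsto {s : ℂ} (hs : ‖s‖ = 1) {p : ℕ} (hp : 1 ≤ p) {θ : ℝ} (hθ : θ = 1 - 1 / 2 ^ p) :
    Tendsto (fun K => gK s p K) atTop (𝓝 ((θ:ℂ) / (1 - (1 - θ) * s))) := by
  have hq : (1:ℂ) - θ = 1 / 2 ^ p := by rw [hθ]; push_cast; ring
  set q : ℂ := 1 / 2 ^ p with hqd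
  have hqn : ‖q * s‖ < 1 := by
    rw [norm_mul, hs, mul_one, hqd, norm_div, norm_one, norm_pow, Complex.norm_ofNat]
    rw [div_lt_one (by positivity)]
    exact one_lt_pow₀ (by norm_num) (by omega)
  have hne : 1 - q * s ≠ 0 := by
    intro h
    have : q * s = 1 := (sub_eq_zero.1 h).symm
    rw [this] at hqn; simp at hqn
  have e : ∀ K, gK s p K = 1 + (s - 1) * q * ∑ k ∈ Finset.range K, (q * s) ^ k := by
    intro K
    unfold gK
    rw [Finset.sum_range_succ', add_comm, Finset.mul_sum]
    congr 1
    · simp [acoef]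
    · refine Finset.sum_congr rfl fun k _ => ?_
      have : (1:ℂ) / 2 ^ ((k + 1) * p) = q ^ (k + 1) := by
        rw [hqd, div_pow, one_pow, ← pow_mul, mul_comm]
      rw [this]
      simp only [acoef]
      ring
  have ht := ((hasSum_geometric_of_norm_lt_one hqn).tendsto_sum_nat.const_mul ((s - 1) * q)).const_add 1
  simp_rw [e]
  convert ht using 2
  rw [hq]
  have h2 : (θ:ℂ) = 1 - q := by rw [← hq]; ring
  rw [h2]
  field_simp
  ring

/-! ### Part 6 : discrete Gronwall and convergence of transforms -/

lemma gron {F : ℕ → ℂ} {E : ℂ} (hE : ‖E‖ ≤ 1) (h0 : F 0 = 1) {N : ℕ} {a b : ℝ} (ha : 0 ≤ a)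
    (hb : 0 ≤ b) (h1 : ∀ n < N, ‖F (n + 1) - E * F n‖ ≤ a)
    (h2 : ∀ n, N ≤ n → ‖F (n + 1) - E * F n‖ ≤ b) (n : ℕ) :
    ‖F n - E ^ n‖ ≤ N * a + n * b := by
  have key : ‖F n - E ^ n‖ ≤ (min n N : ℕ) * a + n * b := by
    induction n with
    | zero => simp [h0]
    | succ n ih =>
      have e : F (n + 1) - E ^ (n + 1) = (F (n + 1) - E * F n) + E * (F n - E ^ n) := by ring
      have hm : ‖E * (F n - E ^ n)‖ ≤ ‖F n - E ^ n‖ := by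
        rw [norm_mul]; exact mul_le_of_le_one_left (norm_nonneg _) hE
      rw [e]
      refine (norm_add_le _ _).trans ?_
      by_cases hn : n < N
      · have := h1 n hn
        rw [min_eq_left hn.le] at ih
        rw [min_eq_left (by omega)]
        push_cast
        nlinarith
      · have := h2 n (by omega)
        rw [min_eq_right (by omega)] at ih
        rw [min_eq_right (by omega)]
        push_cast
        nlinarith
  refine key.trans ?_
  have : ((min n N : ℕ) : ℝ) ≤ N := by exact_mod_cast min_le_right _ _
  nlinarith

lemma lamC_re {θ : ℝ} (h0 : 0 < θ) (h1 : θ ≤ 1) {s : ℂ} (hs : ‖s‖ = 1) : 0 ≤ (lamC θ s).re := by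
  rw [lamC_eq θ h0 h1 s hs, Complex.sub_re, Complex.re_ofReal_mul, Complex.ofReal_re]
  have hn : ‖(θ:ℂ) * s / (1 - ((1 - θ : ℝ) : ℂ) * s)‖ ≤ 1 := by
    have hq : ‖((1 - θ : ℝ) : ℂ) * s‖ = 1 - θ := by
      rw [norm_mul, hs, mul_one, Complex.norm_real, Real.norm_eq_abs, abs_of_nonneg (by linarith)]
    have hd : θ ≤ ‖1 - ((1 - θ : ℝ) : ℂ) * s‖ := by
      have := norm_sub_norm_le (1:ℂ) (((1 - θ : ℝ) : ℂ) * s)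
      rw [hq, norm_one] at this
      linarith
    rw [norm_div, norm_mul, hs, mul_one, Complex.norm_real, Real.norm_eq_abs, abs_of_pos h0]
    exact div_le_one_of_le₀ hd (norm_nonneg _)
  have := (Complex.re_le_norm _).trans hn
  nlinarith

lemma main_step {s : ℂ} (hs : ‖s‖ = 1) {z : ℝ × ℝ} {r θ : ℝ} (hθ0 : 0 < θ) (hθ1 : θ ≤ 1)
    (h : Inside z r) {p K M : ℕ} (hp : 1 ≤ p) (hL : Loc z r p K) (hM : K * p + 1 ≤ 2 * M)
    (hMr : 1 / 2 ^ M ≤ r ^ 3) (hsm : ‖lamC θ s‖ * (4 * r ^ 2) ≤ 1) (n : ℕ) :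
    ‖FF s (Metric.ball z r) n - Complex.exp (-(lamC θ s * (4 * r ^ 2))) ^ n‖ ≤
      2 * M * (4 * r ^ 2 * (2 + 2 * ‖lamC θ s‖)) + n * (4 * r ^ 2 *
        (2 * (8 * r * M + 2 / 2 ^ (K * p) + 4 * r + 2 * (K + 1) * r ^ 2 +
          2 * (K + 1) * (16 * r ^ 3 + 16 * r ^ 2 * M) + ‖gK s p K - θ / (1 - (1 - θ) * s)‖) +
          ‖lamC θ s‖ ^ 2 * (4 * r ^ 2))) := by
  have hr := h.1
  have hU := measU z r
  have hmu := mu_ball_real h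
  set U := Metric.ball z r
  set lam := lamC θ s with hlam
  set g : ℂ := θ / (1 - (1 - θ) * s) with hg
  have hlg : lam = (1 - s) * g := rfl
  set E := Complex.exp (-(lam * (4 * r ^ 2))) with hE
  have hr2 : ‖(4 * (r:ℂ) ^ 2)‖ = 4 * r ^ 2 := by
    rw [norm_mul, norm_pow, Complex.norm_real, Real.norm_eq_abs, abs_of_pos hr]; simp
  have hln : ‖-(lam * (4 * r ^ 2))‖ = ‖lam‖ * (4 * r ^ 2) := by rw [norm_neg, norm_mul, hr2]
  have hE1 : ‖E‖ ≤ 1 := by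
    rw [hE, Complex.norm_exp, Real.exp_le_one_iff]
    have : (4 * (r:ℂ) ^ 2) = ((4 * r ^ 2 : ℝ) : ℂ) := by push_cast; ring
    rw [this, Complex.neg_re, Complex.re_mul_ofReal]
    have := lamC_re hθ0 hθ1 hs
    rw [← hlam] at this
    have : 0 ≤ lam.re * (4 * r ^ 2) := by positivity
    linarith
  have hs2 : ‖s - 1‖ ≤ 2 := (norm_sub_le _ _).trans (by rw [hs, norm_one]; norm_num)
  have hEa := Complex.norm_exp_sub_one_le (x := -(lam * (4 * r ^ 2))) (by rw [hln]; exact hsm)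
  have hEb := Complex.norm_exp_sub_one_sub_id_le (x := -(lam * (4 * r ^ 2))) (by rw [hln]; exact hsm)
  rw [hln, ← hE] at hEa hEb
  have h0 : FF s U 0 = 1 := by simp [FF, cnt]
  have := gron (F := FF s U) (E := E) hE1 h0 (N := 2 * M) (a := 4 * r ^ 2 * (2 + 2 * ‖lam‖))
    (b := 4 * r ^ 2 *
        (2 * (8 * r * M + 2 / 2 ^ (K * p) + 4 * r + 2 * (K + 1) * r ^ 2 +
          2 * (K + 1) * (16 * r ^ 3 + 16 * r ^ 2 * M) + ‖gK s p K - g‖) +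
          ‖lam‖ ^ 2 * (4 * r ^ 2))) (by positivity) (by positivity) ?_ ?_ n
  · push_cast at this; exact this
  · intro m _
    rw [FF_succ hs hU]
    have e : FF s U m + (s - 1) * XX s U m - E * FF s U m =
      (s - 1) * XX s U m - (E - 1) * FF s U m := by ring
    rw [e]
    refine (norm_sub_le _ _).trans ?_
    rw [norm_mul, norm_mul]
    have a1 := mul_le_mul hs2 (norm_XX_le hs hU m) (norm_nonneg _) (by norm_num)
    have a2 := mul_le_mul hEa (norm_FF_le hs U m) (norm_nonneg _) (by positivity)
    rw [hmu] at a1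
    linarith
  · intro m hm
    obtain ⟨d, hd⟩ : ∃ d, K * p + 1 + d = 2 * M := ⟨2 * M - (K * p + 1), by omega⟩
    obtain ⟨n', rfl⟩ : ∃ n', m = K * p + d + n' := ⟨m - (K * p + d), by omega⟩
    have hme := main_est hs h (n' := n') hp hL hd g
    rw [FF_succ hs hU]
    set X := XX s U (K * p + d + n')
    set F := FF s U (K * p + d + n') with hF
    have hFn : ‖F‖ ≤ 1 := norm_FF_le hs _ _
    have e : F + (s - 1) * X - E * F =
      (s - 1) * (X - 4 * r ^ 2 * g * F) - (E - 1 - -(lam * (4 * r ^ 2))) * F := by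
      rw [hlg]; ring
    rw [e]
    refine (norm_sub_le _ _).trans ?_
    rw [norm_mul, norm_mul]
    have a1 := mul_le_mul hs2 hme (norm_nonneg _) (by norm_num)
    have a2 := mul_le_mul hEb hFn (norm_nonneg _) (by positivity)
    have b1 : (16:ℝ) / 2 ^ M ≤ 4 * r ^ 2 * (4 * r) := by
      have : (16:ℝ) / 2 ^ M = 16 * (1 / 2 ^ M) := by ring
      rw [this]; nlinarith
    have b2 : 8 * r * (K + 1) / 2 ^ M ≤ 4 * r ^ 2 * (2 * (K + 1) * r ^ 2) := by
      have : 8 * r * (K + 1) / 2 ^ M = 8 * r * (K + 1) * (1 / 2 ^ M) := by ring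
      rw [this]
      calc _ ≤ 8 * r * (K + 1) * r ^ 3 := mul_le_mul_of_nonneg_left hMr (by positivity)
        _ = _ := by ring
    have b3 : 4 * r ^ 2 * (2 * (K + 1) * (16 / 2 ^ M + 16 * r ^ 2 * M)) ≤
        4 * r ^ 2 * (2 * (K + 1) * (16 * r ^ 3 + 16 * r ^ 2 * M)) := by
      have : (16:ℝ) / 2 ^ M ≤ 16 * r ^ 3 := by
        have : (16:ℝ) / 2 ^ M = 16 * (1 / 2 ^ M) := by ring
        rw [this]; linarith
      gcongr
    linarith

lemma exists_M : ∃ M : ℝ → ℕ, (∀ᶠ r : ℝ in 𝓝[>] 0, 1 / 2 ^ (M r) ≤ r ^ 3) ∧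
    Tendsto (fun r => r * (M r : ℝ)) (𝓝[>] 0) (𝓝 0) := by
  refine ⟨fun r => ⌈-(3 * Real.logb 2 r)⌉₊, ?_, ?_⟩
  · filter_upwards [ev_small one_pos] with r ⟨hr, hr1⟩
    have h1 : -(3 * Real.logb 2 r) ≤ (⌈-(3 * Real.logb 2 r)⌉₊ : ℝ) := Nat.le_ceil _
    set m := ⌈-(3 * Real.logb 2 r)⌉₊
    have h2 : (2:ℝ) ^ (-(3 * Real.logb 2 r)) ≤ 2 ^ (m:ℝ) :=
      Real.rpow_le_rpow_of_exponent_le (by norm_num) h1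
    have h3 : (2:ℝ) ^ (-(3 * Real.logb 2 r)) = (r ^ 3)⁻¹ := by
      rw [Real.rpow_neg (by norm_num), mul_comm, Real.rpow_mul (by norm_num),
        Real.rpow_logb (by norm_num) (by norm_num) hr]
      norm_cast
    rw [h3, Real.rpow_natCast] at h2
    rw [one_div]
    exact inv_le_of_inv_le₀ (by positivity) h2
  · have hl : Tendsto (fun r : ℝ => -(3 / Real.log 2) * (Real.log r * r) + r) (𝓝[>] 0) (𝓝 0) := by
      have h0 : Tendsto (fun r : ℝ => Real.log r * r) (𝓝[>] 0) (𝓝 0) := by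
        simpa using tendsto_log_mul_rpow_nhdsGT_zero (r := 1) one_pos
      have h1 := h0.const_mul (-(3 / Real.log 2))
      have h2 : Tendsto (fun r : ℝ => r) (𝓝[>] 0) (𝓝 0) := tendsto_nhdsWithin_of_tendsto_nhds tendsto_id
      simpa using h1.add h2
    refine tendsto_of_tendsto_of_tendsto_of_le_of_le' tendsto_const_nhds hl ?_ ?_
    · filter_upwards [ev_small one_pos] with r ⟨hr, hr1⟩
      positivity
    · filter_upwards [ev_small one_pos] with r ⟨hr, hr1⟩
      have hlog : Real.logb 2 r ≤ 0 := Real.logb_nonpos (by norm_num) hr.le hr1.le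
      have := (Nat.ceil_lt_add_one (a := -(3 * Real.logb 2 r)) (by linarith)).le
      have := mul_le_mul_of_nonneg_left this hr.le
      refine this.trans (le_of_eq ?_)
      unfold Real.logb
      ring

noncomputable def nn (t r : ℝ) : ℕ := ⌊t / (4 * r ^ 2)⌋₊ + 1

lemma nn_tendsto {t : ℝ} (ht : 0 < t) :
    Tendsto (fun r => (nn t r : ℝ) * (4 * r ^ 2)) (𝓝[>] 0) (𝓝 t) := by
  have h2 : Tendsto (fun r : ℝ => r) (𝓝[>] 0) (𝓝 0) := tendsto_nhdsWithin_of_tendsto_nhds tendsto_id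
  have h3 : Tendsto (fun r : ℝ => t + 4 * r ^ 2) (𝓝[>] 0) (𝓝 t) := by
    simpa using ((h2.pow 2).const_mul 4).const_add t
  refine tendsto_of_tendsto_of_tendsto_of_le_of_le' tendsto_const_nhds h3 ?_ ?_
  · filter_upwards [ev_small one_pos] with r ⟨hr, hr1⟩
    have := (Nat.lt_floor_add_one (t / (4 * r ^ 2))).le
    rw [div_le_iff₀ (by positivity)] at this
    unfold nn; push_cast; exact this
  · filter_upwards [ev_small one_pos] with r ⟨hr, hr1⟩
    have := Nat.floor_le (a := t / (4 * r ^ 2)) (by positivity)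
    rw [le_div_iff₀ (by positivity)] at this
    unfold nn; push_cast; linarith

lemma FF_tendsto {s : ℂ} (hs : ‖s‖ = 1) {z : ℝ × ℝ}
    (hz : z ∈ Set.Ioo (0:ℝ) 1 ×ˢ Set.Ioo (0:ℝ) 1) (hy : Nondyadic z.2) {p : ℕ} (hp : 1 ≤ p)
    (hper : bakerMap^[p] z = z) (hmin : ∀ j, 1 ≤ j → j < p → bakerMap^[j] z ≠ z) {θ : ℝ}
    (hθ : θ = 1 - 1 / 2 ^ p) (hθ0 : 0 < θ) (hθ1 : θ ≤ 1) {t : ℝ} (ht : 0 < t) :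
    Tendsto (fun r => FF s (Metric.ball z r) (nn t r)) (𝓝[>] 0)
      (𝓝 (Complex.exp (-(lamC θ s * t)))) := by
  obtain ⟨M, hM1, hM2⟩ := exists_M
  have hid : Tendsto (fun r : ℝ => r) (𝓝[>] 0) (𝓝 0) := tendsto_nhdsWithin_of_tendsto_nhds tendsto_id
  have hnn := nn_tendsto ht
  set L := ‖lamC θ s‖ with hL
  have hE : Tendsto (fun r : ℝ => Complex.exp (-(lamC θ s * (4 * r ^ 2))) ^ (nn t r)) (𝓝[>] 0)
      (𝓝 (Complex.exp (-(lamC θ s * t)))) := by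
    have h1 : Tendsto (fun r : ℝ => (((nn t r : ℝ) * (4 * r ^ 2) : ℝ) : ℂ)) (𝓝[>] 0) (𝓝 (t:ℂ)) :=
      (Complex.continuous_ofReal.tendsto t).comp hnn
    have h2 := (Complex.continuous_exp.tendsto _).comp ((h1.const_mul (lamC θ s)).neg)
    refine h2.congr fun r => ?_
    simp only [Function.comp]
    rw [← Complex.exp_nat_mul]
    congr 1
    push_cast
    ring
  have hdiff : Tendsto (fun r => FF s (Metric.ball z r) (nn t r) -
      Complex.exp (-(lamC θ s * (4 * r ^ 2))) ^ (nn t r)) (𝓝[>] 0) (𝓝 0) := by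
    rw [tendsto_zero_iff_norm_tendsto_zero]
    rw [Metric.tendsto_nhds]
    intro ε hε
    -- choose K
    have hc : Tendsto (fun K : ℕ => t * (2 * (2 * (1 / 2 ^ (K * p)) +
        ‖gK s p K - θ / (1 - (1 - θ) * s)‖))) atTop (𝓝 0) := by
      have g1 := (gK_tendsto hs hp hθ).sub_const ((θ:ℂ) / (1 - (1 - θ) * s))
      rw [sub_self] at g1
      have g2 : Tendsto (fun K : ℕ => (1:ℝ) / 2 ^ (K * p)) atTop (𝓝 0) := by
        have h := tendsto_pow_atTop_nhds_zero_of_lt_one (r := (1:ℝ) / 2 ^ p) (by positivity)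
          (by rw [div_lt_one (by positivity)]; exact one_lt_pow₀ (by norm_num) (by omega))
        refine h.congr fun K => ?_
        rw [div_pow, one_pow, ← pow_mul, mul_comm]
      have := (((g2.const_mul 2).add g1.norm).const_mul 2).const_mul t
      simpa using this
    obtain ⟨K, hK⟩ := (hc.eventually (gt_mem_nhds hε)).exists
    have hG : Tendsto (fun r : ℝ => 8 * (r * (M r)) * r * (2 + 2 * L) + (nn t r * (4 * r ^ 2)) *
        (2 * (8 * (r * M r) + 2 * (1 / 2 ^ (K * p)) + 4 * r + 2 * (K + 1) * r ^ 2 +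
          2 * (K + 1) * (16 * r ^ 3 + 16 * r * (r * M r)) + ‖gK s p K - θ / (1 - (1 - θ) * s)‖) +
          L ^ 2 * (4 * r ^ 2))) (𝓝[>] 0) (𝓝 (8 * 0 * 0 * (2 + 2 * L) + t *
        (2 * (8 * 0 + 2 * (1 / 2 ^ (K * p)) + 4 * 0 + 2 * (K + 1) * 0 ^ 2 +
          2 * (K + 1) * (16 * 0 ^ 3 + 16 * 0 * 0) + ‖gK s p K - θ / (1 - (1 - θ) * s)‖) +
          L ^ 2 * (4 * 0 ^ 2)))) := by
      refine (((hM2.const_mul 8).mul hid).mul_const _).add (hnn.mul ?_)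
      refine Tendsto.add (Tendsto.const_mul _ ?_) (((hid.pow 2).const_mul 4).const_mul _)
      refine Tendsto.add_const _ (Tendsto.add (Tendsto.add (Tendsto.add (Tendsto.add_const _ ?_)
        ?_) ?_) ?_)
      · exact hM2.const_mul 8
      · exact hid.const_mul 4
      · exact (hid.pow 2).const_mul _
      · exact (((hid.pow 3).const_mul 16).add ((hid.const_mul 16).mul hM2)).const_mul _
    have hsm : Tendsto (fun r : ℝ => L * (4 * r ^ 2)) (𝓝[>] 0) (𝓝 0) := by
      simpa using ((hid.pow 2).const_mul 4).const_mul L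
    filter_upwards [(tendsto_order.1 hG).2 ε (by simpa using hK), inside_ev hz,
      loc_ev hy hp hper hmin K, hM1, hsm.eventually (gt_mem_nhds one_pos), ev_small one_pos,
      ev_small (δ := 1 / 2 ^ (K * p + 1)) (by positivity)] with r h1 h2 h3 h4 h5 h6 h7
    have hMK : K * p + 1 ≤ 2 * M r := by
      have : (1:ℝ) / 2 ^ (M r) < 1 / 2 ^ (K * p + 1) := by
        refine (h4.trans ?_).trans_lt h7.2
        exact pow_le_of_le_one h6.1.le h6.2.le (by norm_num)
      have := lt_of_one_div_lt_one_div (by positivity) this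
      have := (pow_lt_pow_iff_right₀ (by norm_num : (1:ℝ) < 2)).1 this
      omega
    have := main_step hs hθ0 hθ1 h2 hp h3 hMK h4 h5.le (nn t r)
    rw [dist_zero_right, norm_norm]
    refine this.trans_lt (lt_of_eq_of_lt ?_ h1)
    rw [← hL]
    ring
  have := hdiff.add hE
  simpa using this

/-! ### Part 7 : Fourier inversion and conclusion -/

lemma cnt_le (U : Set (ℝ × ℝ)) (n : ℕ) (w : ℝ × ℝ) : cnt U n w ≤ n := by
  unfold cnt
  refine (Finset.sum_le_card_nsmul _ _ 1 fun i _ => ?_).trans (by simp)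
  by_cases h : bakerMap^[i] w ∈ U
  · rw [ind_of_mem h]
  · rw [ind_of_notMem h]; simp

lemma FF_eq_sum (s : ℂ) {U : Set (ℝ × ℝ)} (hU : MeasurableSet U) (n : ℕ) :
    FF s U n = ∑ m ∈ Finset.range (n + 1), (muQ.real {w | cnt U n w = m} : ℂ) * s ^ m := by
  have hm : ∀ m, MeasurableSet {w | cnt U n w = m} := fun m =>
    measurable_cnt hU n (measurableSet_singleton m)
  unfold FF
  have : ∀ w, s ^ cnt U n w = ∑ m ∈ Finset.range (n + 1),
      {w | cnt U n w = m}.indicator (fun _ => s ^ m) w := by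
    intro w
    rw [Finset.sum_eq_single (cnt U n w)]
    · rw [Set.indicator_of_mem]; simp
    · intro m _ hne
      rw [Set.indicator_of_notMem]
      exact fun h => hne h.symm
    · intro h
      exact absurd (Finset.mem_range.2 (Nat.lt_succ_of_le (cnt_le U n w))) h
  simp_rw [this]
  rw [integral_finsetSum]
  · refine Finset.sum_congr rfl fun m _ => ?_
    rw [integral_indicator_const _ (hm m)]
    simp
  · intro m _
    exact (integrable_const _).indicator (hm m)

lemma inversion {U : Set (ℝ × ℝ)} (hU : MeasurableSet U) (n k : ℕ) :
    ∫ u in (0:ℝ)..(2 * Real.pi), Complex.exp ((((-k : ℤ) : ℂ) * Complex.I) * u) *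
      FF (Complex.exp (u * Complex.I)) U n = 2 * Real.pi * (muQ.real {w | cnt U n w = k} : ℂ) := by
  have h : ∀ u : ℝ, Complex.exp ((((-k : ℤ) : ℂ) * Complex.I) * u) *
      FF (Complex.exp (u * Complex.I)) U n = ∑ m ∈ Finset.range (n + 1),
        (muQ.real {w | cnt U n w = m} : ℂ) *
          Complex.exp (((((m:ℤ) - k : ℤ) : ℂ) * Complex.I) * u) := by
    intro u
    rw [FF_eq_sum _ hU, Finset.mul_sum]
    refine Finset.sum_congr rfl fun m _ => ?_
    rw [← Complex.exp_nat_mul, mul_left_comm, ← Complex.exp_add]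
    congr 2
    push_cast
    ring
  simp_rw [h]
  rw [intervalIntegral.integral_finsetSum]
  · simp_rw [intervalIntegral.integral_const_mul, aux_int_exp]
    by_cases hk : k ∈ Finset.range (n + 1)
    · rw [Finset.sum_eq_single k]
      · rw [if_pos (by simp)]; ring
      · intro m _ hne
        rw [if_neg (by omega), mul_zero]
      · exact fun h' => absurd hk h'
    · have : {w | cnt U n w = k} = ∅ := by
        ext w
        simp only [Set.mem_setOf_eq, Set.mem_empty_iff_false, iff_false]
        intro hw
        exact hk (Finset.mem_range.2 (Nat.lt_succ_of_le (hw ▸ cnt_le U n w)))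
      rw [this]
      simp only [measureReal_empty, Complex.ofReal_zero, mul_zero]
      refine Finset.sum_eq_zero fun m hm => ?_
      rw [if_neg, mul_zero]
      rw [sub_eq_zero]
      intro h'
      have : m = k := by exact_mod_cast h'
      exact hk (this ▸ hm)
  · intro m _
    exact Continuous.intervalIntegrable (by fun_prop) _ _

lemma prob_tendsto {z : ℝ × ℝ}
    (hz : z ∈ Set.Ioo (0:ℝ) 1 ×ˢ Set.Ioo (0:ℝ) 1) (hy : Nondyadic z.2) {p : ℕ} (hp : 1 ≤ p)
    (hper : bakerMap^[p] z = z) (hmin : ∀ j, 1 ≤ j → j < p → bakerMap^[j] z ≠ z) {θ : ℝ}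
    (hθ : θ = 1 - 1 / 2 ^ p) (hθ0 : 0 < θ) (hθ1 : θ ≤ 1) {t : ℝ} (ht : 0 < t) (k : ℕ)
    (hk : 1 ≤ k) :
    Tendsto (fun r => muQ.real {w | cnt (Metric.ball z r) (nn t r) w = k}) (𝓝[>] 0)
      (𝓝 (Real.exp (-(θ * t)) *
          ∑ j ∈ Finset.Icc 1 k,
            (1 - θ) ^ (k - j) * θ ^ (2 * j) * t ^ j / (Nat.factorial j) *
              ((k - 1).choose (j - 1)))) := by
  have hnorm : ∀ u : ℝ, ‖Complex.exp (u * Complex.I)‖ = 1 := fun u =>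
    Complex.norm_exp_ofReal_mul_I u
  have hnorm' : ∀ u : ℝ, ‖Complex.exp ((((-k : ℤ) : ℂ) * Complex.I) * u)‖ = 1 := fun u => by
    have : (((-k : ℤ) : ℂ) * Complex.I) * u = ((-k * u : ℝ) : ℂ) * Complex.I := by
      push_cast; ring
    rw [this]; exact Complex.norm_exp_ofReal_mul_I _
  have hlim : Tendsto (fun r => ∫ u in (0:ℝ)..(2 * Real.pi),
      Complex.exp ((((-k : ℤ) : ℂ) * Complex.I) * u) *
      FF (Complex.exp (u * Complex.I)) (Metric.ball z r) (nn t r)) (𝓝[>] 0)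
      (𝓝 (∫ u in (0:ℝ)..(2 * Real.pi), Complex.exp ((((-k : ℤ) : ℂ) * Complex.I) * u) *
        Complex.exp (-(lamC θ (Complex.exp (u * Complex.I)) * t)))) := by
    refine intervalIntegral.tendsto_integral_filter_of_dominated_convergence (fun _ => (1:ℝ))
      ?_ ?_ ?_ ?_
    · refine Eventually.of_forall fun r => ?_
      refine Continuous.aestronglyMeasurable ?_
      simp_rw [FF_eq_sum _ (measU z r)]
      fun_prop
    · refine Eventually.of_forall fun r => Eventually.of_forall fun u _ => ?_
      rw [norm_mul, hnorm', one_mul]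
      exact norm_FF_le (hnorm u) _ _
    · exact intervalIntegrable_const
    · refine Eventually.of_forall fun u _ => ?_
      exact (FF_tendsto (hnorm u) hz hy hp hper hmin hθ hθ0 hθ1 ht).const_mul _
  rw [limit_coeff θ t hθ0 hθ1 k hk] at hlim
  simp_rw [inversion (measU z _)] at hlim
  have hpi : (2 * (Real.pi:ℂ)) ≠ 0 := by
    simp [Real.pi_ne_zero]
  have h2 := hlim.const_mul (2 * (Real.pi:ℂ))⁻¹
  simp_rw [inv_mul_cancel_left₀ hpi] at h2
  have h3 := (Complex.continuous_re.tendsto _).comp h2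
  simpa only [Function.comp_def, Complex.ofReal_re] using h3

/-- Pólya–Aeppli (compound Poisson) limit law for the number of visits to
shrinking `ℓ^∞` balls around a periodic point `z` of minimal period `p` with
non-dyadic coordinates, for the standard baker's map. With
`θ = 1 - 2^{-p}`, for every `t > 0` and integer `k ≥ 1`,
`Leb{x ∈ [0,1]² : ∑_{i=0}^{⌊t/Leb B_∞(z,r)⌋} 1_{B_∞(z,r)}(T^i x) = k}`
tends to `e^{-θt} ∑_{j=1}^k (1-θ)^{k-j} θ^{2j} (t^j/j!) C(k-1, j-1)` as
`r → 0`. Here `Metric.ball` on `ℝ × ℝ` is the open ball for the sup metric. -/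
theorem stmt_16 (z : ℝ × ℝ) (hz : z ∈ Set.Ioo (0:ℝ) 1 ×ˢ Set.Ioo (0:ℝ) 1)
    (hx : Nondyadic z.1) (hy : Nondyadic z.2) (p : ℕ) (hp : 1 ≤ p)
    (hper : bakerMap^[p] z = z)
    (hmin : ∀ j, 1 ≤ j → j < p → bakerMap^[j] z ≠ z)
    (θ : ℝ) (hθ : θ = 1 - (2:ℝ) ^ (-(p:ℤ))) :
    ∀ t : ℝ, 0 < t → ∀ k : ℕ, 1 ≤ k →
      Tendsto (fun r : ℝ =>
          (volume.restrict unitSq)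
            {x : ℝ × ℝ |
              (∑ i ∈ Finset.range
                  (⌊t / ((volume.restrict unitSq) (Metric.ball z r)).toReal⌋₊ + 1),
                (Metric.ball z r).indicator (fun _ => (1:ℕ)) (bakerMap^[i] x)) = k})
        (𝓝[>] 0)
        (𝓝 (ENNReal.ofReal (Real.exp (-(θ * t)) *
          ∑ j ∈ Finset.Icc 1 k,
            (1 - θ) ^ (k - j) * θ ^ (2 * j) * t ^ j / (Nat.factorial j) *
              ((k - 1).choose (j - 1))))) := by
  have h2p : (1:ℝ) < 2 ^ p := one_lt_pow₀ (by norm_num) (by omega)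
  have hθ' : θ = 1 - 1 / 2 ^ p := by
    rw [hθ, zpow_neg, zpow_natCast, one_div]
  have hq : (1:ℝ) / 2 ^ p < 1 := by rw [div_lt_one (by positivity)]; exact h2p
  have hq0 : (0:ℝ) < 1 / 2 ^ p := by positivity
  intro t ht k hk
  have h := prob_tendsto hz hy hp hper hmin hθ' (by linarith) (by linarith) ht k hk
  have h' := (ENNReal.continuous_ofReal.tendsto _).comp h
  refine h'.congr' ?_
  filter_upwards [inside_ev hz] with r hr
  simp only [Function.comp]
  rw [restrict_unitSq, mu_ball hr, ENNReal.toReal_ofReal (by positivity),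
    ofReal_measureReal (by finiteness)]
  rfl
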